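/- arXiv:2011.08025 — 2 statements merged into one kernel-verified Lean document; each statement's English description precedes it below -/
import Mathlib

section
/- Let n = 2r be an integer divisible by 4 and let F be a field with char F = 0 or char F > r. Then the Pfaffian [r+1, r+2, …, n] (the Pfaffian of the submatrix of Y with rows and columns r+1, …, n), regarded as an element of F[V], is not a zero divisor. -/
open scoped Matrix

noncomputable section

namespace PR

/-- The polynomial ring `R[Y_{ij} : 1 ≤ i, j ≤ n]`, `n = 2r`. -/
abbrev PolyRing (r : ℕ) (R : Type*) [CommRing R] :=
  MvPolynomial (Fin (2 * r) × Fin (2 * r)) R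

/-- The standard symplectic form matrix `J` (`n = 2r`). -/
def Jmat (r : ℕ) (R : Type*) [CommRing R] : Matrix (Fin (2 * r)) (Fin (2 * r)) R :=
  Matrix.of fun i j =>
    if (j : ℕ) = (i : ℕ) + r then 1 else if (i : ℕ) = (j : ℕ) + r then -1 else 0

/-- The generic `n × n` matrix of indeterminates. -/
def Ygen (r : ℕ) (R : Type*) [CommRing R] :
    Matrix (Fin (2 * r)) (Fin (2 * r)) (MvPolynomial (Fin (2 * r) × Fin (2 * r)) R) :=
  Matrix.of fun i j => MvPolynomial.X (i, j)

/-- The defining ideal of the scheme `V`. -/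
def VIdeal (r : ℕ) (R : Type*) [CommRing R] :
    Ideal (MvPolynomial (Fin (2 * r) × Fin (2 * r)) R) :=
  Ideal.span
    ({p | ∃ i j, p = (Ygen r R + (Ygen r R)ᵀ) i j} ∪
     {p | ∃ i, p = Ygen r R i i} ∪
     {p | ∃ i j, p = ((Ygen r R)ᵀ * Jmat r (PolyRing r R) * Ygen r R) i j} ∪
     {p | ∃ k, p = (Matrix.charpoly (-(Jmat r (PolyRing r R) * Ygen r R)) - Polynomial.X ^ (2 * r)).coeff k})

/-- The coordinate ring `R[V]`. -/
abbrev FV (r : ℕ) (R : Type*) [CommRing R] :=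
  MvPolynomial (Fin (2 * r) × Fin (2 * r)) R ⧸ VIdeal r R

/-- The pfaffian of an `m × m` matrix (nonzero only for even `m`), defined as a signed sum over
permutations `σ` with `σ(2i-1) < σ(2i)` for each pair and `σ(1) < σ(3) < ⋯` (here 0-indexed). -/
def pf {m : ℕ} {R : Type*} [CommRing R] (A : Matrix (Fin m) (Fin m) R) : R :=
  ∑ σ ∈ Finset.univ.filter (fun σ : Equiv.Perm (Fin m) =>
      (∀ i : Fin (m / 2),
        σ ⟨2 * i.val, by have := i.isLt; omega⟩ < σ ⟨2 * i.val + 1, by have := i.isLt; omega⟩) ∧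
      ∀ i j : Fin (m / 2), i < j →
        σ ⟨2 * i.val, by have := i.isLt; omega⟩ < σ ⟨2 * j.val, by have := j.isLt; omega⟩),
    (Equiv.Perm.sign σ : ℤ) •
      ∏ i : Fin (m / 2),
        A (σ ⟨2 * i.val, by have := i.isLt; omega⟩) (σ ⟨2 * i.val + 1, by have := i.isLt; omega⟩)

/-- `[i₁, …, i₂ₗ]`: the pfaffian of the submatrix of `Y` given by a list of indices. -/
def listPf {n : ℕ} {R : Type*} [CommRing R] (Y : Matrix (Fin n) (Fin n) R)
    (L : List (Fin n)) : R :=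
  pf (Matrix.of fun a b : Fin L.length => Y (L.get a) (L.get b))

/-- The product of pfaffians associated to a tableau (rows as lists of entries),
as a polynomial. -/
def tabPoly (r : ℕ) (R : Type*) [CommRing R] (T : List (List (Fin (2 * r)))) :
    MvPolynomial (Fin (2 * r) × Fin (2 * r)) R :=
  (T.map (listPf (Ygen r R))).prod

/-- `[T]`, the class of the product of pfaffians of the rows of `T` in `R[V]`. -/
def tabElem (r : ℕ) (R : Type*) [CommRing R] (T : List (List (Fin (2 * r)))) : FV r R :=
  Ideal.Quotient.mk (VIdeal r R) (tabPoly r R T)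

/-- Position of an index in the order `1̄ ≺ 1 ≺ 2̄ ≺ 2 ≺ ⋯ ≺ r̄ ≺ r`, where `ī := r + i`
(0-indexed: `ī` is `r + i - 1` and `i` is `i - 1`). -/
def ordIdx (r : ℕ) (x : Fin (2 * r)) : ℕ :=
  if x.val < r then 2 * x.val + 1 else 2 * (x.val - r)

/-- A list of rows represents a tableau of shape a partition: row lengths weakly decreasing
and positive. -/
def IsShape {α : Type*} (T : List (List α)) : Prop :=
  (T.map List.length).Chain' (fun a b => b ≤ a) ∧ ∀ row ∈ T, row ≠ []

/-- An even-tableau: every row has even length. -/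
def IsEvenTab {α : Type*} (T : List (List α)) : Prop :=
  ∀ row ∈ T, Even row.length

/-- Standard: entries strictly increase along each row and weakly increase down each column,
with respect to the order `≺`. -/
def IsStandard (r : ℕ) (T : List (List (Fin (2 * r)))) : Prop :=
  (∀ row ∈ T, row.Chain' (fun a b => ordIdx r a < ordIdx r b)) ∧
  ∀ (i t : ℕ) (hi : i + 1 < T.length) (ht' : t < (T[i]'(Nat.lt_of_succ_lt hi)).length)
    (ht : t < (T[i + 1]'hi).length),
    ordIdx r ((T[i]'(Nat.lt_of_succ_lt hi))[t]'ht') ≤ ordIdx r ((T[i + 1]'hi)[t]'ht)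

/-- The symplectic condition: the entries `p` and `p̄` (0-indexed: values `p` and `r + p`
for `p < r`) occur only in the first `p + 1` columns (0-indexed: columns `t ≤ p`). -/
def IsSymplectic (r : ℕ) (T : List (List (Fin (2 * r)))) : Prop :=
  ∀ (i t : ℕ) (hi : i < T.length) (ht : t < (T[i]'hi).length) (p : ℕ), p < r →
    (((T[i]'hi)[t]'ht).val = p ∨ ((T[i]'hi)[t]'ht).val = r + p) → t ≤ p

/-- A symplectic standard even-tableau. -/
def IsSSET (r : ℕ) (T : List (List (Fin (2 * r)))) : Prop :=
  IsShape T ∧ IsEvenTab T ∧ IsStandard r T ∧ IsSymplectic r T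

/-- A canonical tableau: in column `j` only `j̄` appears (0-indexed: column `t` contains
only the value `r + t`). -/
def IsCanonical (r : ℕ) (T : List (List (Fin (2 * r)))) : Prop :=
  ∀ (i t : ℕ) (hi : i < T.length) (ht : t < (T[i]'hi).length), ((T[i]'hi)[t]'ht).val = r + t

/-- The set `V(C)` of matrices. -/
def MemV (r : ℕ) {C : Type*} [CommRing C] (Y : Matrix (Fin (2 * r)) (Fin (2 * r)) C) : Prop :=
  Y = -Yᵀ ∧ (∀ i, Y i i = 0) ∧ Yᵀ * Jmat r C * Y = 0 ∧
    Matrix.charpoly (-(Jmat r C * Y)) = Polynomial.X ^ (2 * r)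

/-- The embedding `i ↦ i` of `{1, …, r}` into `{1, …, n}`. -/
def emb (r : ℕ) (i : Fin r) : Fin (2 * r) := ⟨i.val, by have := i.isLt; omega⟩

/-- The embedding `i ↦ ī = r + i` of `{1, …, r}` into `{1, …, n}`. -/
def embBar (r : ℕ) (i : Fin r) : Fin (2 * r) := ⟨r + i.val, by have := i.isLt; omega⟩

/-- The index list of `[P, Q̄]`: with `Γ₀ = P ∩ Q = {γ₁ < ⋯ < γ_λ}`, the list
`γ₁, γ̄₁, …, γ_λ, γ̄_λ` followed by `P ∖ Γ₀` in increasing order and then the bars of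
`Q ∖ Γ₀` in increasing order. -/
def pqList (r : ℕ) (P Q : Finset (Fin r)) : List (Fin (2 * r)) :=
  ((P ∩ Q).sort (· ≤ ·)).flatMap (fun γ => [emb r γ, embBar r γ]) ++
    ((P \ Q).sort (· ≤ ·)).map (emb r) ++ ((Q \ P).sort (· ≤ ·)).map (embBar r)

/-- The pfaffian `[P, Q̄]` of the matrix `Y`. -/
def pfPQ (r : ℕ) {C : Type*} [CommRing C] (Y : Matrix (Fin (2 * r)) (Fin (2 * r)) C)
    (P Q : Finset (Fin r)) : C :=
  listPf Y (pqList r P Q)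

/-- The defining ideal of the scheme `W`. -/
def WIdeal (r : ℕ) (R : Type*) [CommRing R] : Ideal (PolyRing r R) :=
  Ideal.span
    ({p | ∃ i j, p = (Jmat r (PolyRing r R) * (Ygen r R)ᵀ * Jmat r (PolyRing r R)
            + Ygen r R) i j} ∪
     {p | ∃ i j, p = (Ygen r R * Ygen r R) i j} ∪
     {p | ∃ k, p = (Matrix.charpoly (Ygen r R) - Polynomial.X ^ (2 * r)).coeff k})

/-- The coordinate ring `R[W]`. -/
abbrev FW (r : ℕ) (R : Type*) [CommRing R] := PolyRing r R ⧸ WIdeal r R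

section Pfaffian

variable {S : Type*} [CommRing S] {M N : Type*} [AddCommGroup M] [Module S M]
  [AddCommGroup N] [Module S N]

open CliffordAlgebra in
/-- The Wick isomorphism of the exterior algebra attached to an alternating form. -/
def wick (B : LinearMap.BilinForm S M) (hB : B.IsAlt) :
    ExteriorAlgebra S M →ₗ[S] ExteriorAlgebra S M :=
  changeForm (B := -B) (Q := 0) (Q' := 0) (by
    ext m
    simp [LinearMap.BilinMap.toQuadraticMap_apply, hB m])

/-- The Pfaffian as a linear functional on the exterior algebra. -/
def pfForm (B : LinearMap.BilinForm S M) (hB : B.IsAlt) : ExteriorAlgebra S M →ₗ[S] S :=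
  ExteriorAlgebra.algebraMapInv.toLinearMap ∘ₗ wick B hB

local notation "ctr" => CliffordAlgebra.contractLeft (Q := (0 : QuadraticForm S _))

variable {B : LinearMap.BilinForm S M} (hB : B.IsAlt)

theorem wick_algebraMap (s : S) :
    wick B hB (algebraMap S _ s) = algebraMap S (ExteriorAlgebra S M) s :=
  CliffordAlgebra.changeForm_algebraMap _ _

theorem wick_ι_mul (m : M) (u : ExteriorAlgebra S M) :
    wick B hB (ExteriorAlgebra.ι S m * u) =
      ExteriorAlgebra.ι S m * wick B hB u + ctr (B m) (wick B hB u) := by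
  refine (CliffordAlgebra.changeForm_ι_mul _ m u).trans ?_
  simp only [LinearMap.neg_apply, map_neg, sub_neg_eq_add]
  rfl

theorem wick_contractLeft (d : Module.Dual S M) (u : ExteriorAlgebra S M) :
    wick B hB (ctr d u) = ctr d (wick B hB u) :=
  CliffordAlgebra.changeForm_contractLeft _ d u

theorem pfForm_one : pfForm B hB 1 = 1 := by
  have := wick_algebraMap hB 1
  simp only [map_one] at this
  simp [pfForm, this]

theorem pfForm_ι_mul (m : M) (u : ExteriorAlgebra S M) :
    pfForm B hB (ExteriorAlgebra.ι S m * u) = pfForm B hB (ctr (B m) u) := by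
  have h : ExteriorAlgebra.algebraMapInv (ExteriorAlgebra.ι S m) = 0 := by
    simp [ExteriorAlgebra.algebraMapInv]
  simp [pfForm, wick_ι_mul, wick_contractLeft, h]

theorem contractLeft_map (f : M →ₗ[S] N) (d : Module.Dual S N) (u : ExteriorAlgebra S M) :
    ctr d (ExteriorAlgebra.map f u) = ExteriorAlgebra.map f (ctr (d ∘ₗ f) u) := by
  induction u using CliffordAlgebra.left_induction with
  | algebraMap s =>
    rw [AlgHom.commutes, CliffordAlgebra.contractLeft_algebraMap,
      CliffordAlgebra.contractLeft_algebraMap, map_zero]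
  | add x y hx hy => simp only [map_add, hx, hy]
  | ι_mul x m hx =>
    have h1 : ExteriorAlgebra.map f (CliffordAlgebra.ι 0 m) = CliffordAlgebra.ι 0 (f m) :=
      ExteriorAlgebra.map_apply_ι f m
    rw [map_mul, h1, CliffordAlgebra.contractLeft_ι_mul, CliffordAlgebra.contractLeft_ι_mul, hx,
      map_sub, map_smul, map_mul, h1]
    rfl

theorem wick_map {B' : LinearMap.BilinForm S N} (hB' : B'.IsAlt) (f : M →ₗ[S] N)
    (hf : ∀ a b, B' (f a) (f b) = B a b) (u : ExteriorAlgebra S M) :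
    wick B' hB' (ExteriorAlgebra.map f u) = ExteriorAlgebra.map f (wick B hB u) := by
  induction u using CliffordAlgebra.left_induction with
  | algebraMap s =>
    rw [AlgHom.commutes, wick_algebraMap, wick_algebraMap, AlgHom.commutes]
  | add x y hx hy => simp only [map_add, hx, hy]
  | ι_mul x m hx =>
    have h1 : ∀ m, ExteriorAlgebra.map f (ExteriorAlgebra.ι S m) = ExteriorAlgebra.ι S (f m) :=
      ExteriorAlgebra.map_apply_ι f
    change wick B' hB' (ExteriorAlgebra.map f (ExteriorAlgebra.ι S m * x)) =
      ExteriorAlgebra.map f (wick B hB (ExteriorAlgebra.ι S m * x))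
    have h2 : B' (f m) ∘ₗ f = B m := by
      ext b
      simp [hf]
    rw [map_mul, h1, wick_ι_mul, wick_ι_mul, hx, map_add, map_mul, h1, contractLeft_map, h2]

theorem algebraMapInv_map (f : M →ₗ[S] N) (u : ExteriorAlgebra S M) :
    ExteriorAlgebra.algebraMapInv (ExteriorAlgebra.map f u) =
      ExteriorAlgebra.algebraMapInv u := by
  have : (ExteriorAlgebra.algebraMapInv (R := S)).comp (ExteriorAlgebra.map f) =
      ExteriorAlgebra.algebraMapInv := by
    ext m
    simp [ExteriorAlgebra.algebraMapInv]
  exact DFunLike.congr_fun this u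

theorem contractLeft_mul_map (f : M →ₗ[S] N) (d : Module.Dual S N) (hd : d ∘ₗ f = 0)
    (a : ExteriorAlgebra S N) (u : ExteriorAlgebra S M) :
    ctr d (a * ExteriorAlgebra.map f u) = ctr d a * ExteriorAlgebra.map f u := by
  induction a using CliffordAlgebra.left_induction with
  | algebraMap s =>
    rw [CliffordAlgebra.contractLeft_algebraMap_mul, contractLeft_map, hd,
      CliffordAlgebra.contractLeft_algebraMap]
    simp
  | add x y hx hy => simp only [add_mul, map_add, hx, hy]
  | ι_mul x m hx =>
    rw [mul_assoc, CliffordAlgebra.contractLeft_ι_mul, CliffordAlgebra.contractLeft_ι_mul, hx,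
      sub_mul, smul_mul_assoc, mul_assoc]

theorem wick_map_mul_map {P : Type*} [AddCommGroup P] [Module S P]
    {B₂ : LinearMap.BilinForm S N} (hB₂ : B₂.IsAlt) {C : LinearMap.BilinForm S P} (hC : C.IsAlt)
    (f : M →ₗ[S] P) (g : N →ₗ[S] P) (hf : ∀ a b, C (f a) (f b) = B a b)
    (hg : ∀ a b, C (g a) (g b) = B₂ a b) (hfg : ∀ a b, C (f a) (g b) = 0)
    (u : ExteriorAlgebra S M) (v : ExteriorAlgebra S N) :
    wick C hC (ExteriorAlgebra.map f u * ExteriorAlgebra.map g v) =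
      ExteriorAlgebra.map f (wick B hB u) * ExteriorAlgebra.map g (wick B₂ hB₂ v) := by
  induction u using CliffordAlgebra.left_induction with
  | algebraMap s =>
    rw [wick_algebraMap, AlgHom.commutes, ← Algebra.smul_def, map_smul, wick_map hB₂ hC g hg,
      Algebra.smul_def]
  | add x y hx hy => simp only [add_mul, map_add, hx, hy]
  | ι_mul x m hx =>
    have h1 : ∀ m, ExteriorAlgebra.map f (ExteriorAlgebra.ι S m) = ExteriorAlgebra.ι S (f m) :=
      ExteriorAlgebra.map_apply_ι f
    have h2 : C (f m) ∘ₗ f = B m := by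
      ext b
      simp [hf]
    change wick C hC (ExteriorAlgebra.map f (ExteriorAlgebra.ι S m * x) *
        ExteriorAlgebra.map g v) =
      ExteriorAlgebra.map f (wick B hB (ExteriorAlgebra.ι S m * x)) *
        ExteriorAlgebra.map g (wick B₂ hB₂ v)
    rw [map_mul (ExteriorAlgebra.map f), h1, mul_assoc, wick_ι_mul, wick_ι_mul, hx, map_add,
      map_mul (ExteriorAlgebra.map f), h1, contractLeft_mul_map _ _ (by ext b; simp [hfg]),
      contractLeft_map, h2, add_mul, mul_assoc]

theorem pfForm_map_mul_map {P : Type*} [AddCommGroup P] [Module S P]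
    {B₂ : LinearMap.BilinForm S N} (hB₂ : B₂.IsAlt) {C : LinearMap.BilinForm S P} (hC : C.IsAlt)
    (f : M →ₗ[S] P) (g : N →ₗ[S] P) (hf : ∀ a b, C (f a) (f b) = B a b)
    (hg : ∀ a b, C (g a) (g b) = B₂ a b) (hfg : ∀ a b, C (f a) (g b) = 0)
    (u : ExteriorAlgebra S M) (v : ExteriorAlgebra S N) :
    pfForm C hC (ExteriorAlgebra.map f u * ExteriorAlgebra.map g v) =
      pfForm B hB u * pfForm B₂ hB₂ v := by
  simp [pfForm, wick_map_mul_map hB hB₂ hC f g hf hg hfg, algebraMapInv_map]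

/-- The product in the exterior algebra of a list of vectors. -/
def wedge (l : List M) : ExteriorAlgebra S M := (l.map (ExteriorAlgebra.ι S)).prod

theorem contractLeft_wedge (d : Module.Dual S M) (l : List M) :
    ctr d (wedge l) =
      ∑ k : Fin l.length, ((-1) ^ (k : ℕ) * d l[k]) • wedge (S := S) (l.eraseIdx k) := by
  induction l with
  | nil => simp [wedge]
  | cons a l ih =>
    have h : wedge (S := S) (a :: l) = CliffordAlgebra.ι 0 a * wedge l := by
      simp [wedge, ExteriorAlgebra.ι]
    rw [h, CliffordAlgebra.contractLeft_ι_mul, ih]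
    simp only [List.length_cons]
    rw [Fin.sum_univ_succ, sub_eq_add_neg, Finset.mul_sum, ← Finset.sum_neg_distrib]
    simp only [Fin.val_zero, pow_zero, one_mul, Fin.getElem_fin, List.getElem_cons_zero,
      List.eraseIdx_cons_zero, Fin.val_succ, List.getElem_cons_succ, List.eraseIdx_cons_succ]
    congr 1
    refine Finset.sum_congr rfl fun k _ => ?_
    rw [mul_smul_comm, ← neg_smul, pow_succ]
    simp [wedge, ExteriorAlgebra.ι]

theorem wedge_perm {l l' : List M} (h : l.Perm l') :
    wedge (S := S) l = wedge l' ∨ wedge (S := S) l = -wedge l' := by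
  induction h with
  | nil => simp
  | cons a _ ih =>
    simp only [wedge, List.map_cons, List.prod_cons] at ih ⊢
    rcases ih with h | h <;> simp [h]
  | swap a b l =>
    right
    simp only [wedge, List.map_cons, List.prod_cons, ← mul_assoc]
    rw [← neg_mul, eq_neg_of_add_eq_zero_left (ExteriorAlgebra.ι_add_mul_swap b a)]
  | trans _ _ h1 h2 =>
    rcases h1 with h1 | h1 <;> rcases h2 with h2 | h2 <;> simp [h1, h2]

theorem wedge_eq_zero_of_not_nodup {l : List M} (h : ¬ l.Nodup) : wedge (S := S) l = 0 := by
  have key : ∀ a : M, wedge (S := S) [a, a] = 0 := fun a => by simp [wedge]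
  obtain ⟨a, ha⟩ := List.exists_duplicate_iff_not_nodup.mpr h
  obtain ⟨l', hl'⟩ := (List.duplicate_iff_sublist.mp ha).exists_perm_append
  rcases wedge_perm (S := S) hl' with h | h <;>
  · rw [h]
    simp [wedge, ← mul_assoc]

end Pfaffian

section ListPfaffian

variable {S : Type*} [CommRing S] {κ : Type*}

/-- Alternating matrices. -/
def IsAltMat (y : Matrix κ κ S) : Prop := (∀ i, y i i = 0) ∧ ∀ i j, y i j = -y j i

/-- The Pfaffian of the submatrix indexed by a list, by expansion along the first row. -/
def pfl (y : Matrix κ κ S) : List κ → S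
  | [] => 1
  | a :: l => ∑ k : Fin l.length, (-1) ^ (k : ℕ) * y a l[k] * pfl y (l.eraseIdx k)
termination_by l => l.length
decreasing_by
  have := k.isLt
  simp only [List.length_cons, List.length_eraseIdx]
  split_ifs; omega

theorem pfl_nil (y : Matrix κ κ S) : pfl y [] = 1 := by rw [pfl]

theorem pfl_cons (y : Matrix κ κ S) (a : κ) (l : List κ) :
    pfl y (a :: l) =
      ∑ k : Fin l.length, (-1) ^ (k : ℕ) * y a l[k] * pfl y (l.eraseIdx k) := by rw [pfl]

theorem pfl_pair (y : Matrix κ κ S) (a b : κ) : pfl y [a, b] = y a b := by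
  simp [pfl_cons, pfl_nil]

/-- Induction along the row expansion. -/
theorem list_erase_induction {P : List κ → Prop} (nil : P [])
    (cons : ∀ a l, (∀ k : Fin l.length, P (l.eraseIdx k)) → P (a :: l)) (l : List κ) : P l := by
  induction hn : l.length using Nat.strong_induction_on generalizing l with
  | _ n ih =>
    cases l with
    | nil => exact nil
    | cons a l =>
      refine cons a l fun k => ih _ ?_ _ rfl
      have := k.isLt
      rw [← hn, List.length_cons, List.length_eraseIdx]
      split_ifs; omega

theorem map_pfl {S' : Type*} [CommRing S'] (φ : S →+* S') (y : Matrix κ κ S) (l : List κ) :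
    φ (pfl y l) = pfl (y.map φ) l := by
  induction l using list_erase_induction with
  | nil => simp [pfl_nil]
  | cons a l ih => simp [pfl_cons, ih]

theorem pfl_eq_zero_of_odd (y : Matrix κ κ S) (l : List κ) (h : Odd l.length) : pfl y l = 0 := by
  induction l using list_erase_induction with
  | nil => simp at h
  | cons a l ih =>
    rw [pfl_cons]
    refine Finset.sum_eq_zero fun k _ => ?_
    rw [ih k, mul_zero]
    rw [List.length_eraseIdx, if_pos k.isLt]
    have := k.isLt
    rw [List.length_cons] at h
    grind

theorem pfl_smul (c : S) (y : Matrix κ κ S) (l : List κ) (h : Even l.length) :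
    pfl (c • y) l = c ^ (l.length / 2) * pfl y l := by
  induction l using list_erase_induction with
  | nil => simp [pfl_nil]
  | cons a l ih =>
    rw [pfl_cons, pfl_cons, Finset.mul_sum]
    refine Finset.sum_congr rfl fun k _ => ?_
    have hk := k.isLt
    have hl : (l.eraseIdx k).length = l.length - 1 := by rw [List.length_eraseIdx, if_pos hk]
    rw [List.length_cons] at h
    have h2 : (l.length + 1) / 2 = (l.length - 1) / 2 + 1 := by omega
    rw [ih k (by rw [hl]; grind), hl, List.length_cons, h2, Matrix.smul_apply, smul_eq_mul,
      pow_succ]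
    ring

theorem pfl_diag_mul (d : κ → S) (y : Matrix κ κ S) (l : List κ) :
    pfl (Matrix.of fun i j => d i * d j * y i j) l = (l.map d).prod * pfl y l := by
  induction l using list_erase_induction with
  | nil => simp [pfl_nil]
  | cons a l ih =>
    rw [pfl_cons, pfl_cons, Finset.mul_sum]
    refine Finset.sum_congr rfl fun k _ => ?_
    have h : (l.map d).prod = d l[k] * ((l.eraseIdx k).map d).prod := by
      rw [← List.prod_cons, ← List.map_cons]
      exact (((List.getElem_cons_eraseIdx_perm k.isLt).map d).prod_eq).symm
    rw [ih k, List.map_cons, List.prod_cons, h, Matrix.of_apply]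
    ring

theorem pfForm_wedge {M : Type*} [AddCommGroup M] [Module S M] {B : LinearMap.BilinForm S M}
    (hB : B.IsAlt) (v : κ → M) (l : List κ) :
    pfForm B hB (wedge (l.map v)) = pfl (Matrix.of fun i j => B (v i) (v j)) l := by
  induction l using list_erase_induction with
  | nil => simp [pfl_nil, wedge, pfForm_one]
  | cons a l ih =>
    have h : wedge (S := S) ((a :: l).map v) = ExteriorAlgebra.ι S (v a) * wedge (l.map v) := by
      simp [wedge]
    rw [h, pfForm_ι_mul, contractLeft_wedge, map_sum, pfl_cons]
    rw [← Fin.sum_congr' _ (List.length_map (f := v) (as := l)).symm]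
    refine Finset.sum_congr rfl fun k _ => ?_
    rw [map_smul, smul_eq_mul]
    simp only [Fin.val_cast, Fin.getElem_fin, List.getElem_map, List.eraseIdx_map, ih k,
      Matrix.of_apply]

/-- The Pfaffian of a finite set of indices, well defined up to sign. -/
def pfs (y : Matrix κ κ S) (x : Finset κ) : S := pfl y x.toList

theorem map_pfs {S' : Type*} [CommRing S'] (φ : S →+* S') (y : Matrix κ κ S) (x : Finset κ) :
    φ (pfs y x) = pfs (y.map φ) x := map_pfl φ y _

variable [Fintype κ] [DecidableEq κ]

theorem isAlt_toBilin' {y : Matrix κ κ S} (hy : IsAltMat y) : (Matrix.toBilin' y).IsAlt := by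
  intro v
  rw [Matrix.toBilin'_apply']
  have : (v ⬝ᵥ y *ᵥ v) = ∑ p : κ × κ, v p.1 * y p.1 p.2 * v p.2 := by
    simp [dotProduct, Matrix.mulVec, Finset.mul_sum, Fintype.sum_prod_type, mul_assoc]
  rw [this]
  refine Finset.sum_involution (fun p _ => (p.2, p.1)) ?_ ?_ ?_ ?_
  · rintro ⟨a, b⟩ -
    simp only
    rw [hy.2 a b]
    ring
  · rintro ⟨a, b⟩ - h heq
    simp only [Prod.mk.injEq] at heq
    obtain ⟨rfl, -⟩ := heq
    simp [hy.1] at h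
  · simp
  · simp

theorem pfForm_toBilin' {y : Matrix κ κ S} (hy : IsAltMat y) (l : List κ) :
    pfForm _ (isAlt_toBilin' hy) (wedge (l.map fun i => Pi.single i 1)) = pfl y l := by
  rw [pfForm_wedge]
  congr 1
  ext i j
  simp

theorem pfl_perm {y : Matrix κ κ S} (hy : IsAltMat y) {l l' : List κ} (h : l.Perm l') :
    pfl y l = pfl y l' ∨ pfl y l = -pfl y l' := by
  rw [← pfForm_toBilin' hy, ← pfForm_toBilin' hy]
  rcases wedge_perm (S := S) (h.map fun i => (Pi.single i 1 : κ → S)) with h | h <;> simp [h]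

theorem pfl_eq_zero_of_not_nodup {y : Matrix κ κ S} (hy : IsAltMat y) {l : List κ}
    (h : ¬ l.Nodup) : pfl y l = 0 := by
  rw [← pfForm_toBilin' hy, wedge_eq_zero_of_not_nodup, map_zero]
  exact fun h' => h (List.Nodup.of_map _ h')

theorem pfl_eq_pfs {y : Matrix κ κ S} (hy : IsAltMat y) {l : List κ} (h : l.Nodup) :
    pfl y l = pfs y l.toFinset ∨ pfl y l = -pfs y l.toFinset :=
  pfl_perm hy (List.toFinset_toList h).symm

end ListPfaffian

section Exchange

variable {S : Type*} [CommRing S] {M : Type*} [AddCommGroup M] [Module S M]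

/-- The orthogonal sum of two copies of a bilinear form. -/
def doubleForm (B : LinearMap.BilinForm S M) : LinearMap.BilinForm S (M × M) :=
  B.compl₁₂ (LinearMap.fst S M M) (LinearMap.fst S M M) +
    B.compl₁₂ (LinearMap.snd S M M) (LinearMap.snd S M M)

theorem doubleForm_apply (B : LinearMap.BilinForm S M) (z w : M × M) :
    doubleForm B z w = B z.1 w.1 + B z.2 w.2 := rfl

theorem isAlt_doubleForm {B : LinearMap.BilinForm S M} (hB : B.IsAlt) : (doubleForm B).IsAlt :=
  fun z => by simp [doubleForm_apply, hB z.1, hB z.2]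

/-- The similitude `(a, b) ↦ (a - t b, t a + b)`. -/
def rotation (t : S) : M × M →ₗ[S] M × M :=
  (LinearMap.fst S M M - t • LinearMap.snd S M M).prod
    (t • LinearMap.fst S M M + LinearMap.snd S M M)

theorem rotation_apply (t : S) (z : M × M) :
    rotation t z = (z.1 - t • z.2, t • z.1 + z.2) := rfl

theorem doubleForm_rotation (B : LinearMap.BilinForm S M) (t : S) (z w : M × M) :
    doubleForm B (rotation t z) (rotation t w) = ((1 + t ^ 2) • doubleForm B) z w := by
  simp only [rotation_apply, doubleForm_apply, LinearMap.smul_apply, map_add, map_sub, map_smul,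
    LinearMap.add_apply, LinearMap.sub_apply, smul_eq_mul]
  ring

theorem ιMulti_eq_wedge {n : ℕ} (z : Fin n → M) :
    ExteriorAlgebra.ιMulti S n z = wedge (List.ofFn z) := by
  simp [ExteriorAlgebra.ιMulti_apply, wedge, List.map_ofFn, Function.comp_def]

theorem pfForm_ιMulti {B : LinearMap.BilinForm S M} (hB : B.IsAlt) {n : ℕ} (z : Fin n → M) :
    pfForm B hB (ExteriorAlgebra.ιMulti S n z) =
      pfl (Matrix.of fun i j => B (z i) (z j)) (List.finRange n) := by
  rw [ιMulti_eq_wedge, List.ofFn_eq_map, pfForm_wedge]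

theorem pfForm_rotation {B : LinearMap.BilinForm S M} (hB : B.IsAlt) (t : S) {n : ℕ} (hn : Even n)
    (z : Fin n → M × M) :
    pfForm _ (isAlt_doubleForm hB) (ExteriorAlgebra.ιMulti S n fun i => rotation t (z i)) =
      (1 + t ^ 2) ^ (n / 2) *
        pfForm _ (isAlt_doubleForm hB) (ExteriorAlgebra.ιMulti S n z) := by
  rw [pfForm_ιMulti, pfForm_ιMulti]
  have h := pfl_smul (1 + t ^ 2) (Matrix.of fun i j => doubleForm B (z i) (z j))
    (List.finRange n) (by simpa using hn)
  rw [List.length_finRange] at h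
  rw [← h]
  congr 1
  ext i j
  simp [doubleForm_rotation]

theorem pfForm_ιMulti_expand {B : LinearMap.BilinForm S M} (hB : B.IsAlt) {n : ℕ}
    (α β : Fin n → S) (v w : Fin n → M) :
    pfForm B hB (ExteriorAlgebra.ιMulti S n fun i => α i • v i + β i • w i) =
      ∑ s : Finset (Fin n), (∏ i, s.piecewise α β i) *
        pfForm B hB (ExteriorAlgebra.ιMulti S n (s.piecewise v w)) := by
  have h1 : (fun i => α i • v i + β i • w i) = (fun i => α i • v i) + fun i => β i • w i := rfl
  rw [h1, ← AlternatingMap.coe_multilinearMap, MultilinearMap.map_add_univ, map_sum]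
  refine Finset.sum_congr rfl fun s _ => ?_
  have h2 : s.piecewise (fun i => α i • v i) (fun i => β i • w i) =
      fun i => s.piecewise α β i • s.piecewise v w i := by
    ext i
    by_cases h : i ∈ s <;> simp [h]
  rw [h2, MultilinearMap.map_smul_univ, map_smul, smul_eq_mul]

/-- The coefficients of the two expansions compared in the exchange relation. -/
theorem exchange_identity {B : LinearMap.BilinForm S M} (hB : B.IsAlt) {n : ℕ} (hn : Even n)
    (v : Fin n → M) (t : S) (a b : Finset (Fin n)) (hab : Disjoint a b) :
    (1 + t ^ 2) ^ (a.card + b.card) *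
        ∑ s : Finset (Fin n),
          (∏ i, s.piecewise (fun i => if i ∈ b then 0 else 1)
            (fun i => if i ∈ a then 0 else if i ∈ b then 1 else t) i) *
          pfForm _ (isAlt_doubleForm hB) (ExteriorAlgebra.ιMulti S n
            (s.piecewise (fun i => ((v i, 0) : M × M)) fun i => (0, v i))) =
      (1 + t ^ 2) ^ (n / 2) *
        ∑ s : Finset (Fin n),
          (∏ i, s.piecewise (fun i => if i ∈ b then t else 1)
            (fun i => if i ∈ a then -t else if i ∈ b then 1 else 0) i) *
          pfForm _ (isAlt_doubleForm hB) (ExteriorAlgebra.ιMulti S n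
            (s.piecewise (fun i => ((v i, 0) : M × M)) fun i => (0, v i))) := by
  rw [← pfForm_ιMulti_expand, ← pfForm_ιMulti_expand, ← pfForm_rotation hB t hn]
  have h1 : (1 + t ^ 2) ^ (a.card + b.card) =
      ∏ i : Fin n, (if i ∈ a ∪ b then 1 + t ^ 2 else 1) := by
    rw [Finset.prod_ite_mem, Finset.univ_inter, Finset.prod_const, Finset.card_union_of_disjoint hab]
  rw [h1, ← smul_eq_mul, ← map_smul, ← AlternatingMap.coe_multilinearMap,
    ← MultilinearMap.map_smul_univ]
  congr 2
  ext1 i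
  have hd : i ∈ a → i ∉ b := fun h => Finset.disjoint_left.mp hab h
  by_cases ha : i ∈ a
  · simp [ha, hd ha, rotation_apply, add_smul, mul_smul, pow_two]
  · by_cases hb : i ∈ b
    · simp [ha, hb, rotation_apply, add_smul, mul_smul, pow_two, add_comm]
    · simp [ha, hb, rotation_apply]

variable {κ : Type*} [Fintype κ] [DecidableEq κ]

theorem pfForm_doubleForm_piecewise {y : Matrix κ κ S} (hy : IsAltMat y) {n : ℕ} (c : Fin n → κ)
    (s : Finset (Fin n)) {p : S}
    (hp : p = pfl y (((List.finRange n).filter (· ∈ s)).map c) *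
      pfl y (((List.finRange n).filter (· ∉ s)).map c)) :
    let g := pfForm _ (isAlt_doubleForm (isAlt_toBilin' hy)) (ExteriorAlgebra.ιMulti S n
      (s.piecewise (fun i => ((Pi.single (c i) 1, 0) : (κ → S) × (κ → S)))
        fun i => (0, Pi.single (c i) 1)))
    g = p ∨ g = -p := by
  intro g
  set z : Fin n → (κ → S) × (κ → S) :=
    s.piecewise (fun i => (Pi.single (c i) 1, 0)) fun i => (0, Pi.single (c i) 1) with hz
  set l₁ := (List.finRange n).filter (· ∈ s)
  set l₂ := (List.finRange n).filter (· ∉ s)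
  have hperm : (l₁ ++ l₂).Perm (List.finRange n) := by
    have := List.filter_append_perm (fun i => decide (i ∈ s)) (List.finRange n)
    simpa [l₁, l₂] using this
  have e₁ : l₁.map z = (l₁.map fun i => (Pi.single (c i) 1 : κ → S)).map (LinearMap.inl S _ _) := by
    rw [List.map_map]
    refine List.map_congr_left fun i hi => ?_
    simp only [l₁, List.mem_filter, decide_eq_true_eq] at hi
    simp [hz, hi.2]
  have e₂ : l₂.map z = (l₂.map fun i => (Pi.single (c i) 1 : κ → S)).map (LinearMap.inr S _ _) := by
    rw [List.map_map]
    refine List.map_congr_left fun i hi => ?_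
    simp only [l₂, List.mem_filter, decide_eq_true_eq] at hi
    simp [hz, hi.2]
  have hw : ∀ (f : (κ → S) →ₗ[S] (κ → S) × (κ → S)) (l : List (κ → S)),
      wedge (S := S) (l.map f) = ExteriorAlgebra.map f (wedge l) := by
    intro f l
    simp [wedge, map_list_prod, Function.comp_def]
  have hprod : pfForm _ (isAlt_doubleForm (isAlt_toBilin' hy)) (wedge ((l₁ ++ l₂).map z)) = p := by
    have : wedge (S := S) ((l₁ ++ l₂).map z) = wedge (l₁.map z) * wedge (l₂.map z) := by
      simp [wedge]
    rw [this, e₁, e₂, hw, hw, pfForm_map_mul_map (isAlt_toBilin' hy) (isAlt_toBilin' hy), hp,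
      ← pfForm_toBilin' hy, ← pfForm_toBilin' hy, List.map_map, List.map_map]
    · rfl
    all_goals intros; simp [doubleForm_apply]
  have hg : g = pfForm _ (isAlt_doubleForm (isAlt_toBilin' hy))
      (wedge ((List.finRange n).map z)) := by
    rw [← List.ofFn_eq_map, ← ιMulti_eq_wedge]
  rw [hg, ← hprod]
  rcases wedge_perm (S := S) (hperm.map z) with h | h <;> rw [h] <;> simp

open Polynomial in
/-- The exchange relation for products of two Pfaffians. -/
theorem exchange {y : Matrix κ κ S} (hy : IsAltMat y) {n : ℕ} (hn : Even n) (c : Fin n → κ)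
    {a b s₀ : Finset (Fin n)} (hab : Disjoint a b) (hcard : 2 * (a.card + b.card) ≤ n)
    (ha : a ⊆ s₀) (hb : Disjoint s₀ b) (K : AddSubgroup S) {p : Finset (Fin n) → S}
    (hp : ∀ s, p s = pfl y (((List.finRange n).filter (· ∈ s)).map c) *
      pfl y (((List.finRange n).filter (· ∉ s)).map c))
    (h₁ : ∀ s, (∀ i, i ∉ a → i ∉ b → i ∈ s) → p s ∈ K)
    (h₂ : ∀ s, s ≠ s₀ → a ⊆ s → Disjoint s b → s.card = s₀.card → p s ∈ K) :
    p s₀ ∈ K := by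
  have hyC : IsAltMat (y.map (C : S →+* S[X])) :=
    ⟨fun i => by simp [hy.1], fun i j => by
      rw [Matrix.map_apply, Matrix.map_apply, hy.2 i j, map_neg]⟩
  set g : Finset (Fin n) → S[X] := fun s =>
    pfForm _ (isAlt_doubleForm (isAlt_toBilin' hyC)) (ExteriorAlgebra.ιMulti S[X] n
      (s.piecewise (fun i => ((Pi.single (c i) 1, 0) : (κ → S[X]) × (κ → S[X])))
        fun i => (0, Pi.single (c i) 1))) with hg
  have hgp : ∀ s, ∃ q : S, g s = C q ∧ (q = p s ∨ q = -p s) := by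
    intro s
    have := pfForm_doubleForm_piecewise hyC c s (p := C (p s)) (by
      rw [hp s, map_mul, map_pfl, map_pfl])
    rcases this with h | h
    · exact ⟨p s, h, Or.inl rfl⟩
    · exact ⟨-p s, by rw [map_neg]; exact h, Or.inr rfl⟩
  choose q hq hqp using hgp
  have hmem : ∀ s, q s ∈ K ↔ p s ∈ K := by
    intro s
    rcases hqp s with h | h <;> simp [h]
  set φ : ℤ[X] →+* S[X] := mapRingHom (Int.castRingHom S) with hφ
  set wL : Finset (Fin n) → ℤ[X] := fun s => ∏ i, s.piecewise (fun i => if i ∈ b then 0 else 1)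
    (fun i => if i ∈ a then 0 else if i ∈ b then 1 else X) i with hwL
  set wR : Finset (Fin n) → ℤ[X] := fun s => ∏ i, s.piecewise (fun i => if i ∈ b then X else 1)
    (fun i => if i ∈ a then -X else if i ∈ b then 1 else 0) i with hwR
  have hcoeff : ∀ (w : ℤ[X]) (s : Finset (Fin n)) (k : ℕ),
      (φ w * C (q s)).coeff k = w.coeff k • q s := by
    intro w s k
    rw [coeff_mul_C, hφ, coe_mapRingHom, coeff_map]
    simp
  have key : ∑ s, φ (wL s) * C (q s) =
      ∑ s, φ ((1 + X ^ 2) ^ (n / 2 - (a.card + b.card)) * wR s) * C (q s) := by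
    have hreg : IsRegular (((1 : S[X]) + X ^ 2) ^ (a.card + b.card)) := by
      apply Monic.isRegular
      apply Monic.pow
      rw [add_comm]
      exact monic_X_pow_add (n := 2) (by
        refine lt_of_le_of_lt degree_one_le ?_
        norm_num)
    apply hreg.left
    have h := exchange_identity (isAlt_toBilin' hyC) hn (fun i => Pi.single (c i) 1) (X : S[X])
      a b hab
    have hpow : ((1 : S[X]) + X ^ 2) ^ (n / 2) = (1 + X ^ 2) ^ (a.card + b.card) *
        (1 + X ^ 2) ^ (n / 2 - (a.card + b.card)) := by
      rw [← pow_add]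
      congr 1
      omega
    rw [hpow, mul_assoc] at h
    convert h using 2
    · refine Finset.sum_congr rfl fun s _ => ?_
      rw [← hq, hwL, map_prod]
      congr 1
      refine Finset.prod_congr rfl fun i _ => ?_
      by_cases hi : i ∈ s <;> by_cases hia : i ∈ a <;> by_cases hib : i ∈ b <;>
        simp [hi, hia, hib, hφ]
    · rw [Finset.mul_sum]
      refine Finset.sum_congr rfl fun s _ => ?_
      rw [← hq, map_mul, mul_assoc, hwR, map_prod]
      congr 1
      · simp [hφ]
      congr 1
      refine Finset.prod_congr rfl fun i _ => ?_
      by_cases hi : i ∈ s <;> by_cases hia : i ∈ a <;> by_cases hib : i ∈ b <;>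
        simp [hi, hia, hib, hφ]
  have hwL_eq : ∀ s, a ⊆ s → Disjoint s b → wL s = X ^ (n - (s.card + b.card)) := by
    intro s has hbs
    have h1 : wL s = ∏ i, if i ∈ (s ∪ b)ᶜ then X else 1 := by
      refine Finset.prod_congr rfl fun i _ => ?_
      have h3 : i ∈ s → i ∉ b := fun h => Finset.disjoint_left.mp hbs h
      have h4 : i ∈ a → i ∈ s := fun h => has h
      by_cases hi : i ∈ s
      · simp [hi, h3 hi]
      · by_cases hib : i ∈ b <;> simp [hi, hib, mt h4 hi]
    rw [h1, Finset.prod_ite_mem, Finset.univ_inter, Finset.prod_const, Finset.card_compl,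
      Finset.card_union_of_disjoint hbs, Fintype.card_fin]
  have hwL_zero : ∀ s, ¬ (a ⊆ s ∧ Disjoint s b) → wL s = 0 := by
    intro s h
    by_cases has : a ⊆ s
    · have hbs : ¬ Disjoint s b := fun h' => h ⟨has, h'⟩
      obtain ⟨i, hi, hib⟩ := Finset.not_disjoint_iff.mp hbs
      exact Finset.prod_eq_zero (Finset.mem_univ i) (by simp [hi, hib])
    · obtain ⟨i, hia, his⟩ := Finset.not_subset.mp has
      exact Finset.prod_eq_zero (Finset.mem_univ i) (by simp [hia, his])
  have hwR_zero : ∀ s, ¬ (∀ i, i ∉ a → i ∉ b → i ∈ s) → wR s = 0 := by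
    intro s h
    push Not at h
    obtain ⟨i, hia, hib, his⟩ := h
    exact Finset.prod_eq_zero (Finset.mem_univ i) (by simp [hia, hib, his])
  set k := n - (s₀.card + b.card) with hk
  have h := congrArg (fun f => coeff f k) key
  simp only [finsetSum_coeff, hcoeff] at h
  have hR : ∑ s, ((1 + X ^ 2) ^ (n / 2 - (a.card + b.card)) * wR s).coeff k • q s ∈ K := by
    refine sum_mem fun s _ => ?_
    by_cases hs : ∀ i, i ∉ a → i ∉ b → i ∈ s
    · exact zsmul_mem ((hmem s).2 (h₁ s hs)) _
    · simp [hwR_zero s hs]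
  rw [← h, ← Finset.add_sum_erase _ _ (Finset.mem_univ s₀), hwL_eq s₀ ha hb, coeff_X_pow,
    if_pos rfl, one_smul] at hR
  rw [← hmem]
  refine (AddSubgroup.add_mem_cancel_right K (sum_mem fun s hs => ?_)).1 hR
  by_cases hv : a ⊆ s ∧ Disjoint s b
  · rw [hwL_eq s hv.1 hv.2, coeff_X_pow]
    split_ifs with he
    · have h5 : (s ∪ b).card ≤ n := by simpa using Finset.card_le_univ (s ∪ b)
      have h6 : (s₀ ∪ b).card ≤ n := by simpa using Finset.card_le_univ (s₀ ∪ b)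
      rw [Finset.card_union_of_disjoint hv.2] at h5
      rw [Finset.card_union_of_disjoint hb] at h6
      exact zsmul_mem ((hmem s).2 (h₂ s (Finset.ne_of_mem_erase hs) hv.1 hv.2 (by omega))) _
    · simp
  · simp [hwL_zero s hv]

end Exchange

section Straighten

variable {κ : Type*} [Fintype κ]

variable (pos : κ → ℕ) (P : ℕ)

/-- The number of elements of `x` in position at most `a`. -/
def cnt (x : Finset κ) (a : ℕ) : ℕ := (x.filter (pos · ≤ a)).card

/-- A weight decreasing in the position, large enough to compare cardinalities first. -/
def wt (i : κ) : ℕ := Fintype.card κ * P + 1 + (P - pos i)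

variable {pos P}

theorem sum_wt_lt_of_card_lt {x z : Finset κ} (h : x.card < z.card) :
    ∑ i ∈ x, wt pos P i < ∑ i ∈ z, wt pos P i := by
  have h1 : ∑ i ∈ x, wt pos P i ≤ x.card • (Fintype.card κ * P + 1 + P) :=
    Finset.sum_le_card_nsmul _ _ _ fun i _ => by simp only [wt]; omega
  have h2 : z.card • (Fintype.card κ * P + 1) ≤ ∑ i ∈ z, wt pos P i :=
    Finset.card_nsmul_le_sum _ _ _ fun i _ => by simp only [wt]; omega
  have h3 : x.card ≤ Fintype.card κ := Finset.card_le_univ x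
  simp only [smul_eq_mul] at h1 h2
  have h4 : x.card * P ≤ Fintype.card κ * P := Nat.mul_le_mul_right _ h3
  have h5 : (x.card + 1) * (Fintype.card κ * P + 1) ≤ z.card * (Fintype.card κ * P + 1) :=
    Nat.mul_le_mul_right _ h
  linarith

variable {S : Type*} [CommRing S] [DecidableEq κ]

theorem exchange_fintype {y : Matrix κ κ S} (hy : IsAltMat y) {τ : Type*} [Fintype τ]
    [DecidableEq τ] (hn : Even (Fintype.card τ)) (c : τ → κ)
    {a b s₀ : Finset τ} (hab : Disjoint a b) (hcard : 2 * (a.card + b.card) ≤ Fintype.card τ)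
    (ha : a ⊆ s₀) (hb : Disjoint s₀ b) (K : AddSubgroup S) {p : Finset τ → S}
    (hp : ∀ s, p s = pfl y (s.toList.map c) * pfl y (sᶜ.toList.map c))
    (h₁ : ∀ s, (∀ i, i ∉ a → i ∉ b → i ∈ s) → p s ∈ K)
    (h₂ : ∀ s, s ≠ s₀ → a ⊆ s → Disjoint s b → s.card = s₀.card → p s ∈ K) :
    p s₀ ∈ K := by
  set n := Fintype.card τ
  let e : Fin n ≃ τ := (Fintype.equivFin τ).symm
  let q : Finset (Fin n) → S := fun s => pfl y (((List.finRange n).filter (· ∈ s)).map (c ∘ e)) *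
      pfl y (((List.finRange n).filter (· ∉ s)).map (c ∘ e))
  have hperm : ∀ s : Finset (Fin n), (((List.finRange n).filter (· ∈ s)).map (c ∘ e)).Perm
      ((s.map e.toEmbedding).toList.map c) := by
    intro s
    rw [← List.map_map]
    refine List.Perm.map c ?_
    refine (List.perm_ext_iff_of_nodup ?_ (Finset.nodup_toList _)).2 ?_
    · exact ((List.nodup_finRange n).filter _).map e.injective
    · intro i
      simp only [List.mem_map, List.mem_filter, List.mem_finRange, decide_eq_true_eq, true_and,
        Finset.mem_toList, Finset.mem_map, Equiv.coe_toEmbedding]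
  have hq : ∀ s, q s ∈ K ↔ p (s.map e.toEmbedding) ∈ K := by
    intro s
    have h1 := pfl_perm hy (hperm s)
    have h2 := pfl_perm hy (hperm sᶜ)
    have h3 : (sᶜ).map e.toEmbedding = (s.map e.toEmbedding)ᶜ := by
      ext i
      simp
    simp only [Finset.mem_compl] at h2
    rw [h3] at h2
    rw [hp]
    simp only [q]
    rcases h1 with h1 | h1 <;> rcases h2 with h2 | h2 <;> rw [h1, h2] <;> simp
  have hm : ∀ s : Finset τ, (s.map e.symm.toEmbedding).map e.toEmbedding = s := by
    intro s
    ext i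
    simp
  have hmem : ∀ (s : Finset τ) (i : Fin n), i ∈ s.map e.symm.toEmbedding ↔ e i ∈ s := by
    intro s i
    simp
  have := exchange hy hn (c ∘ e) (a := a.map e.symm.toEmbedding) (b := b.map e.symm.toEmbedding)
    (s₀ := s₀.map e.symm.toEmbedding) (by simpa using hab) (by simpa using hcard)
    (by simpa using ha) (by simpa using hb) K (p := q) (fun s => rfl) ?_ ?_
  · rw [hq, hm] at this
    exact this
  · intro s hs
    refine (hq s).2 (h₁ _ fun i hia hib => ?_)
    have := hs (e.symm i) (by simpa using hia) (by simpa using hib)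
    simpa using this
  · intro s hs hsa hsb hc
    refine (hq s).2 (h₂ _ ?_ ?_ ?_ ?_)
    · rintro rfl
      apply hs
      ext i
      simp
    · intro i hi
      have := hsa (show e.symm i ∈ _ by simpa using hi)
      simpa using this
    · rw [Finset.disjoint_left] at hsb ⊢
      intro i hi hib
      exact hsb (a := e.symm i) (by simpa using hi) (by simpa using hib)
    · simpa using hc

theorem pfs_mul_mem_of_cnt_lt {y : Matrix κ κ S} (hy : IsAltMat y) (hpos : ∀ i, pos i < P)
    {x z : Finset κ} (hx : Even x.card) (hz : Even z.card)
    (hv : ∑ i ∈ z, wt pos P i ≤ ∑ i ∈ x, wt pos P i) {a : ℕ} (ha : cnt pos x a < cnt pos z a)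
    (K : AddSubgroup S)
    (hK : ∀ x' z' : Finset κ, Even x'.card → Even z'.card →
      (∀ f : κ → ℕ, ∑ i ∈ x', f i + ∑ i ∈ z', f i = ∑ i ∈ x, f i + ∑ i ∈ z, f i) →
      ∑ i ∈ x, wt pos P i < ∑ i ∈ x', wt pos P i → pfs y x' * pfs y z' ∈ K) :
    pfs y x * pfs y z ∈ K := by
  have hzx : z.card ≤ x.card := by
    by_contra! h
    exact absurd (sum_wt_lt_of_card_lt (pos := pos) (P := P) h) (not_lt.2 hv)
  let c : x ⊕ z → κ := Sum.elim Subtype.val Subtype.val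
  let A : Finset (x ⊕ z) := (Finset.univ.filter fun i : x => pos i ≤ a).map .inl
  let B : Finset (x ⊕ z) := (Finset.univ.filter fun i : z => ¬ pos i ≤ a).map .inr
  let s₀ : Finset (x ⊕ z) := Finset.univ.map .inl
  let p : Finset (x ⊕ z) → S := fun s => pfl y (s.toList.map c) * pfl y (sᶜ.toList.map c)
  have hA : A.card = cnt pos x a := by
    simp only [A, Finset.card_map, cnt]
    rw [← Finset.card_map (Function.Embedding.subtype _)]
    congr 1
    ext i
    simp [and_comm]
  have hB : B.card + cnt pos z a = z.card := by
    have : B.card = (z.filter fun i => ¬ pos i ≤ a).card := by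
      simp only [B, Finset.card_map]
      rw [← Finset.card_map (Function.Embedding.subtype _)]
      congr 1
      ext i
      simp [and_comm]
    rw [this, cnt, add_comm, Finset.card_filter_add_card_filter_not]
  have hs₀ : s₀.card = x.card := by simp [s₀]
  have himg : ∀ s : Finset (x ⊕ z), pfl y (s.toList.map c) = 0 ∨
      (Even (s.image c).card ∧ (∀ f : κ → ℕ, ∑ i ∈ s.image c, f i = ∑ i ∈ s, f (c i)) ∧
        (pfl y (s.toList.map c) = pfs y (s.image c) ∨
          pfl y (s.toList.map c) = - pfs y (s.image c))) := by
    intro s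
    by_cases hnd : (s.toList.map c).Nodup
    · have himg : (s.toList.map c).toFinset = s.image c := by
        ext i
        simp
      have hinj : Set.InjOn c s := by
        intro i hi j hj hij
        exact List.inj_on_of_nodup_map hnd (by simpa using hi) (by simpa using hj) hij
      by_cases he : Even s.card
      · right
        refine ⟨by rwa [Finset.card_image_of_injOn hinj], fun f => Finset.sum_image hinj, ?_⟩
        have := pfl_eq_pfs hy hnd
        rwa [himg] at this
      · left
        exact pfl_eq_zero_of_odd _ _ (by simpa using he)
    · exact Or.inl (pfl_eq_zero_of_not_nodup hy hnd)
  have hmem : ∀ s : Finset (x ⊕ z), (pfl y (s.toList.map c) ≠ 0 →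
      ∑ i ∈ x, wt pos P i < ∑ i ∈ s, wt pos P (c i)) → p s ∈ K := by
    intro s hs
    simp only [p]
    rcases himg s with h0 | ⟨he, hf, hs1⟩
    · simp [h0]
    by_cases h0 : pfl y (s.toList.map c) = 0
    · simp [h0]
    rcases himg sᶜ with h0' | ⟨he', hf', hs1'⟩
    · simp [h0']
    have := hK (s.image c) (sᶜ.image c) he he' (fun f => by
      rw [hf, hf', Finset.sum_add_sum_compl]
      simp only [Fintype.sum_sum_type, c, Sum.elim_inl, Sum.elim_inr]
      rw [Finset.sum_coe_sort x f, Finset.sum_coe_sort z f]) (by rw [hf]; exact hs h0)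
    rcases hs1 with h1 | h1 <;> rcases hs1' with h2 | h2 <;> simpa [h1, h2] using this
  have hmain : p s₀ ∈ K := by
    refine exchange_fintype hy ?_ c (a := A) (b := B) ?_ ?_ ?_ ?_ K (p := p) (fun s => rfl) ?_ ?_
    · simpa using hx.add hz
    · simp only [A, B, Finset.disjoint_left]
      simp
    · simp only [Fintype.card_sum, Fintype.card_coe]
      omega
    · simp only [A, s₀]
      exact Finset.map_subset_map.2 (Finset.filter_subset _ _)
    · simp only [B, s₀, Finset.disjoint_left]
      simp
    · intro s hs
      refine hmem s fun h0 => ?_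
      rcases himg s with h0' | ⟨-, hf, -⟩
      · exact absurd h0' h0
      rw [← hf]
      apply sum_wt_lt_of_card_lt
      have h1 : (s.image c).card = s.card := by simpa using hf fun _ => 1
      rw [h1]
      have h2 : (Finset.univ : Finset (x ⊕ z)) ⊆ s ∪ (A ∪ B) := by
        intro i _
        by_cases hiA : i ∈ A
        · simp [hiA]
        · by_cases hiB : i ∈ B
          · simp [hiB]
          · simp [hs i hiA hiB]
      have h3 := (Finset.card_le_card h2).trans (Finset.card_union_le _ _)
      have h4 := Finset.card_union_le A B
      simp only [Finset.card_univ, Fintype.card_sum, Fintype.card_coe] at h3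
      omega
    · intro s hne hsA hsB hc
      refine hmem s fun _ => ?_
      have h0 : ∑ i ∈ x, wt pos P i = ∑ i ∈ s₀, wt pos P (c i) := by
        simp only [s₀, Finset.sum_map, c, Function.Embedding.inl_apply, Sum.elim_inl]
        exact (Finset.sum_coe_sort x _).symm
      rw [h0, ← Finset.sum_inter_add_sum_sdiff s₀ s, ← Finset.sum_inter_add_sum_sdiff s s₀,
        Finset.inter_comm s s₀]
      have hcard : (s \ s₀).card = (s₀ \ s).card := by
        exact Finset.card_sdiff_comm hc
      have hpos' : 0 < (s₀ \ s).card := by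
        rw [Finset.card_pos, ← Finset.card_pos, ← hcard, Finset.card_pos, Finset.nonempty_iff_ne_empty]
        intro h
        exact hne (Finset.eq_of_subset_of_card_le (Finset.sdiff_eq_empty_iff_subset.1 h) hc.ge)
      refine Nat.add_lt_add_left ?_ _
      calc ∑ i ∈ s₀ \ s, wt pos P (c i) < ∑ i ∈ s₀ \ s, (Fintype.card κ * P + 1 + (P - a)) := by
            refine Finset.sum_lt_sum_of_nonempty (Finset.card_pos.1 hpos') ?_
            intro i hi
            rcases i with i | i
            · have : ¬ pos i ≤ a := by
                intro h
                exact (Finset.mem_sdiff.1 hi).2 (hsA (by simp [A, h]))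
              have := hpos i
              simp only [wt, c, Sum.elim_inl]
              omega
            · simp [s₀] at hi
        _ = ∑ i ∈ s \ s₀, (Fintype.card κ * P + 1 + (P - a)) := by simp [hcard]
        _ ≤ ∑ i ∈ s \ s₀, wt pos P (c i) := by
            refine Finset.sum_le_sum fun i hi => ?_
            rcases i with i | i
            · simp [s₀] at hi
            · have : pos i ≤ a := by
                by_contra h
                exact Finset.disjoint_left.1 hsB (Finset.mem_sdiff.1 hi).1 (by
                  simp only [B, Finset.mem_map, Finset.mem_filter]
                  exact ⟨i, ⟨Finset.mem_univ _, h⟩, rfl⟩)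
              simp only [wt, c, Sum.elim_inr]
              omega
  have hs₀c : s₀ᶜ = Finset.univ.map .inr := by
    ext i
    rcases i with i | i <;> simp [s₀]
  have hperm : ∀ (s : Finset (x ⊕ z)) (w : Finset κ), Set.InjOn c s → s.image c = w →
      (s.toList.map c).Perm w.toList := by
    intro s w hinj hw
    refine (List.perm_ext_iff_of_nodup ?_ (Finset.nodup_toList _)).2 fun i => ?_
    · refine List.Nodup.map_on (fun i hi j hj h => ?_) (Finset.nodup_toList _)
      exact hinj (by simpa using hi) (by simpa using hj) h
    · simp [← hw]
  have e₁ : (s₀.toList.map c).Perm x.toList := by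
    refine hperm _ _ ?_ ?_
    · rintro (i | i) hi (j | j) hj h
      · exact congrArg Sum.inl (Subtype.ext h)
      all_goals simp [s₀] at hi hj
    · ext i
      simp [s₀, c]
  have e₂ : (s₀ᶜ.toList.map c).Perm z.toList := by
    rw [hs₀c]
    refine hperm _ _ ?_ ?_
    · rintro (i | i) hi (j | j) hj h
      on_goal 4 => exact congrArg Sum.inr (Subtype.ext h)
      all_goals simp at hi hj
    · ext i
      simp [c]
  simp only [p] at hmain
  rcases pfl_perm hy e₁ with h1 | h1 <;> rcases pfl_perm hy e₂ with h2 | h2 <;>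
    simpa [h1, h2, pfs] using hmain

end Straighten

section Symplectic

open Nat in
theorem sum_pow_of_sq_eq_zero {R : Type*} [CommRing R] {α : Type*} [DecidableEq α] (z : α → R)
    (hz : ∀ p, z p ^ 2 = 0) (s : Finset α) (g : ℕ) :
    (∑ p ∈ s, z p) ^ g = (g ! : R) * ∑ t ∈ s.powersetCard g, ∏ p ∈ t, z p := by
  induction s using Finset.induction_on generalizing g with
  | empty =>
    cases g with
    | zero => simp
    | succ g => rw [Finset.powersetCard_eq_empty.2 (by simp)]; simp
  | insert a s ha ih =>
    cases g with
    | zero => simp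
    | succ g =>
      obtain ⟨k, h⟩ := Polynomial.powAddExpansion (∑ p ∈ s, z p) (z a) (g + 1)
      rw [Finset.sum_insert ha, add_comm, h, hz, mul_zero, add_zero, Nat.add_sub_cancel, ih, ih,
        Finset.powersetCard_succ_insert ha, Finset.sum_union, Finset.sum_image, mul_add]
      · congr 1
        have : ∑ t ∈ s.powersetCard g, ∏ p ∈ insert a t, z p =
            z a * ∑ t ∈ s.powersetCard g, ∏ p ∈ t, z p := by
          rw [Finset.mul_sum]
          refine Finset.sum_congr rfl fun t ht => ?_
          rw [Finset.prod_insert]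
          exact fun h => ha ((Finset.mem_powersetCard.1 ht).1 h)
        rw [this, Nat.factorial_succ]
        push_cast
        ring
      · intro t ht t' ht' h
        have h1 : a ∉ t := fun h => ha ((Finset.mem_powersetCard.1 ht).1 h)
        have h2 : a ∉ t' := fun h => ha ((Finset.mem_powersetCard.1 ht').1 h)
        rw [← Finset.erase_insert h1, ← Finset.erase_insert h2, h]
      · rw [Finset.disjoint_left]
        intro t ht ht'
        obtain ⟨t', -, rfl⟩ := Finset.mem_image.1 ht'
        exact ha ((Finset.mem_powersetCard.1 ht).1 (Finset.mem_insert_self a t'))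

variable {S : Type*} [CommRing S]

open Nat in
theorem map_prod_eq_of_sum_mul_eq_zero {R : Type*} [CommRing R] [Algebra S R] {α : Type*}
    [DecidableEq α] [Fintype α] (z : α → R) (hz : ∀ p, z p ^ 2 = 0) (θ : R →ₗ[S] S)
    (hθ : ∀ c, θ ((∑ p, z p) * c) = 0) (s : Finset α) (hs : IsUnit (s.card ! : S)) :
    θ (∏ p ∈ s, z p) = (-1) ^ s.card * ∑ t ∈ sᶜ.powersetCard s.card, θ (∏ p ∈ t, z p) := by
  set g := s.card
  have h1 := sum_pow_of_sq_eq_zero z hz s g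
  have h2 := sum_pow_of_sq_eq_zero z hz sᶜ g
  rw [Finset.powersetCard_self, Finset.sum_singleton] at h1
  obtain ⟨c, hc⟩ := sub_dvd_pow_sub_pow (∑ p ∈ s, z p) (-∑ p ∈ sᶜ, z p) g
  rw [sub_neg_eq_add, Finset.sum_add_sum_compl, neg_pow, h1, h2, sub_eq_iff_eq_add] at hc
  have h := congrArg θ hc
  have hsm : ∀ c : R, θ ((g ! : R) * c) = (g ! : S) * θ c := by
    intro c
    rw [← nsmul_eq_mul, map_nsmul, nsmul_eq_mul]
  have hsgn : ∀ c : R, θ ((-1) ^ g * c) = (-1) ^ g * θ c := by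
    intro c
    rcases neg_one_pow_eq_or ℤ g with h | h
    · have h1 : (-1 : R) ^ g = 1 := by exact_mod_cast congrArg (Int.cast : ℤ → R) h
      have h2 : (-1 : S) ^ g = 1 := by exact_mod_cast congrArg (Int.cast : ℤ → S) h
      simp [h1, h2]
    · have h1 : (-1 : R) ^ g = -1 := by exact_mod_cast congrArg (Int.cast : ℤ → R) h
      have h2 : (-1 : S) ^ g = -1 := by exact_mod_cast congrArg (Int.cast : ℤ → S) h
      simp [h1, h2]
  rw [map_add, hθ, zero_add, hsgn, hsm, hsm, map_sum] at h
  apply hs.mul_left_cancel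
  rw [h]
  ring

theorem ι_mul_ι_mem_center {M : Type*} [AddCommGroup M] [Module S M] (a b : M) :
    ExteriorAlgebra.ι S a * ExteriorAlgebra.ι S b ∈ Subalgebra.center S (ExteriorAlgebra S M) := by
  rw [Subalgebra.mem_center_iff]
  intro u
  have hsw : ∀ m n : M, ExteriorAlgebra.ι S m * ExteriorAlgebra.ι S n =
      -(ExteriorAlgebra.ι S n * ExteriorAlgebra.ι S m) := fun m n =>
    eq_neg_of_add_eq_zero_left (ExteriorAlgebra.ι_add_mul_swap m n)
  induction u using ExteriorAlgebra.induction with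
  | algebraMap s => exact Algebra.commutes _ _
  | ι m =>
    rw [← mul_assoc, hsw m a, neg_mul, mul_assoc, hsw m b, mul_neg, neg_neg, mul_assoc]
  | mul u v hu hv => rw [mul_assoc, hv, ← mul_assoc, hu, mul_assoc]
  | add u v hu hv => rw [add_mul, mul_add, hu, hv]

variable {r : ℕ} {y : Matrix (Fin r × Bool) (Fin r × Bool) S}

/-- The conditions on `y` that make it a point of `V`. -/
structure IsIsotropic (y : Matrix (Fin r × Bool) (Fin r × Bool) S) : Prop where
  alt : IsAltMat y
  trace : ∑ p, y (p, false) (p, true) = 0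
  isotropic : ∀ i j, ∑ p, (y (p, true) i * y (p, false) j - y (p, false) i * y (p, true) j) = 0

/-- The degree two element attached to the `p`-th hyperbolic plane. -/
def planeElem (S : Type*) [CommRing S] {r : ℕ} (p : Fin r) :
    ExteriorAlgebra S (Fin r × Bool → S) :=
  ExteriorAlgebra.ι S (Pi.single (p, false) 1) * ExteriorAlgebra.ι S (Pi.single (p, true) 1)

theorem pfForm_sum_planeElem_mul (hy : IsIsotropic y)
    (u : ExteriorAlgebra S (Fin r × Bool → S)) :
    pfForm _ (isAlt_toBilin' hy.alt) ((∑ p, planeElem S p) * u) = 0 := by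
  set B := Matrix.toBilin' y
  set hB := isAlt_toBilin' hy.alt
  let W : Fin r × Bool → Fin r × Bool → S := fun i j =>
    pfForm B hB (CliffordAlgebra.contractLeft (Q := (0 : QuadraticForm S (Fin r × Bool → S)))
      (LinearMap.proj i) (CliffordAlgebra.contractLeft (LinearMap.proj j) u))
  have hrow : ∀ i, B (Pi.single i 1) = ∑ j, y i j • LinearMap.proj j := by
    intro i
    ext j
    simp [B, Pi.single_apply]
  have hterm : ∀ p : Fin r, pfForm B hB (planeElem S p * u) =
      y (p, false) (p, true) * pfForm B hB u -
        ∑ q : (Fin r × Bool) × (Fin r × Bool),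
          y (p, true) q.1 * y (p, false) q.2 * W q.1 q.2 := by
    intro p
    have h1 := CliffordAlgebra.contractLeft_ι_mul
      (Q := (0 : QuadraticForm S (Fin r × Bool → S))) (B (Pi.single (p, false) 1))
      (Pi.single (p, true) 1) u
    rw [planeElem, mul_assoc, pfForm_ι_mul]
    have h2 : pfForm B hB (ExteriorAlgebra.ι S (Pi.single (p, true) 1) *
        CliffordAlgebra.contractLeft (B (Pi.single (p, false) 1)) u) =
        ∑ q : (Fin r × Bool) × (Fin r × Bool),
          y (p, true) q.1 * y (p, false) q.2 * W q.1 q.2 := by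
      rw [pfForm_ι_mul, hrow, hrow, Fintype.sum_prod_type'
        (f := fun i j => y (p, true) i * y (p, false) j * W i j)]
      simp only [map_sum, map_smul, LinearMap.sum_apply, LinearMap.smul_apply, smul_eq_mul, W,
        Finset.mul_sum]
      rw [Finset.sum_comm]
      exact Finset.sum_congr rfl fun i _ => Finset.sum_congr rfl fun j _ => by ring
    rw [← h2]
    refine (congrArg (pfForm B hB) h1).trans ?_
    rw [map_sub, map_smul]
    congr 1
    simp [B]
  rw [Finset.sum_mul, map_sum]
  rw [Finset.sum_congr rfl fun p _ => hterm p, Finset.sum_sub_distrib, ← Finset.sum_mul, hy.trace, zero_mul, zero_sub, neg_eq_zero,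
    Finset.sum_comm]
  have hsymm : ∀ i j, ∑ p : Fin r, y (p, true) i * y (p, false) j =
      ∑ p : Fin r, y (p, true) j * y (p, false) i := by
    intro i j
    rw [← sub_eq_zero, ← Finset.sum_sub_distrib, ← hy.isotropic i j]
    exact Finset.sum_congr rfl fun p _ => by ring
  refine Finset.sum_involution (fun q _ => (q.2, q.1)) ?_ ?_ ?_ ?_
  · rintro ⟨i, j⟩ -
    have hW : W i j = -W j i := by
      simp only [W]
      rw [CliffordAlgebra.contractLeft_comm, map_neg]
    rw [← Finset.sum_mul, ← Finset.sum_mul, hsymm, hW]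
    ring
  · rintro ⟨i, j⟩ - h heq
    simp only [Prod.mk.injEq] at heq
    obtain ⟨rfl, -⟩ := heq
    have hW : W j j = 0 := by
      simp only [W]
      rw [CliffordAlgebra.contractLeft_contractLeft, map_zero]
    simp [hW] at h
  · simp
  · simp

/-- The list of indices of the hyperbolic planes in `s`. -/
def planeList (s : Finset (Fin r)) : List (Fin r × Bool) :=
  s.toList.flatMap fun p => [(p, false), (p, true)]

open Nat in
theorem pfl_planeList_append (hy : IsIsotropic y) (w : List (Fin r × Bool)) (s : Finset (Fin r))
    (hs : IsUnit (s.card ! : S)) :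
    pfl y (planeList s ++ w) =
      (-1) ^ s.card * ∑ t ∈ sᶜ.powersetCard s.card, pfl y (planeList t ++ w) := by
  let M := Fin r × Bool → S
  let z : Fin r → Subalgebra.center S (ExteriorAlgebra S M) := fun p =>
    ⟨planeElem S p, ι_mul_ι_mem_center _ _⟩
  have hz : ∀ p, z p ^ 2 = 0 := by
    intro p
    ext
    have h := eq_neg_of_add_eq_zero_left (ExteriorAlgebra.ι_add_mul_swap (R := S)
      (Pi.single (p, true) 1 : M) (Pi.single (p, false) 1))
    simp only [z, planeElem, pow_two, MulMemClass.mk_mul_mk, ZeroMemClass.coe_zero]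
    rw [mul_assoc, ← mul_assoc (ExteriorAlgebra.ι S (Pi.single (p, true) 1)), h, neg_mul,
      mul_neg, mul_assoc, ExteriorAlgebra.ι_sq_zero, mul_zero, mul_zero, neg_zero]
  let W : ExteriorAlgebra S M := wedge (w.map fun i => Pi.single i 1)
  let θ : Subalgebra.center S (ExteriorAlgebra S M) →ₗ[S] S :=
    pfForm _ (isAlt_toBilin' hy.alt) ∘ₗ LinearMap.mulRight S W ∘ₗ
      (Subalgebra.center S (ExteriorAlgebra S M)).val.toLinearMap
  have hθ : ∀ t : Finset (Fin r), θ (∏ p ∈ t, z p) = pfl y (planeList t ++ w) := by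
    intro t
    rw [← pfForm_toBilin' hy.alt]
    simp only [θ, LinearMap.comp_apply, AlgHom.toLinearMap_apply, LinearMap.mulRight_apply]
    congr 1
    rw [← Finset.prod_map_toList, map_list_prod]
    simp only [planeList, W, wedge, List.map_append, List.prod_append]
    congr 1
    induction t.toList with
    | nil => simp
    | cons a l ih =>
      simp only [List.map_cons, List.prod_cons, List.flatMap_cons, List.map_append,
        List.prod_append, ih]
      simp [z, planeElem]
  have := map_prod_eq_of_sum_mul_eq_zero z hz θ (fun c => by
    have := pfForm_sum_planeElem_mul hy (c * W)
    simp only [θ, LinearMap.comp_apply, AlgHom.toLinearMap_apply, LinearMap.mulRight_apply]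
    rw [map_mul (Subalgebra.val _), mul_assoc, map_sum]
    exact this) s hs
  simpa only [hθ] using this

end Symplectic

section Symplectic

variable {S : Type*} [CommRing S] {r : ℕ} {y : Matrix (Fin r × Bool) (Fin r × Bool) S}

theorem mem_planeList {s : Finset (Fin r)} {i : Fin r × Bool} : i ∈ planeList s ↔ i.1 ∈ s := by
  rcases i with ⟨p, b⟩
  cases b <;> simp [planeList]

theorem nodup_planeList (s : Finset (Fin r)) : (planeList s).Nodup := by
  rw [planeList, List.nodup_flatMap]
  refine ⟨fun p _ => by simp, ?_⟩
  refine s.nodup_toList.imp fun {p q} hpq => ?_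
  simp [Function.onFun, Ne.symm hpq]

theorem toFinset_planeList (s : Finset (Fin r)) : (planeList s).toFinset = s ×ˢ Finset.univ := by
  ext i
  simp [mem_planeList]

/-- The weight of an index set that increases in the reduction to symplectic rows. -/
def planeWt (x : Finset (Fin r × Bool)) : ℕ := ∑ i ∈ x, 2 ^ (i.1 : ℕ)

theorem planeWt_union {x z : Finset (Fin r × Bool)} (h : Disjoint x z) :
    planeWt (x ∪ z) = planeWt x + planeWt z := Finset.sum_union h

theorem pfs_mem_of_not_symplectic (hy : IsIsotropic y) {x : Finset (Fin r × Bool)}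
    (hunit : ∀ g ≤ r, IsUnit (g.factorial : S)) {p : ℕ}
    (hx : p < (x.filter fun i => (i.1 : ℕ) < p).card) (K : AddSubgroup S)
    (hK : ∀ x', x'.card = x.card → planeWt x < planeWt x' → pfs y x' ∈ K) : pfs y x ∈ K := by
  set s : Finset (Fin r) := Finset.univ.filter fun q => (q : ℕ) < p ∧ (q, false) ∈ x ∧ (q, true) ∈ x
  have hsx : s ×ˢ Finset.univ ⊆ x := by
    rintro ⟨q, b⟩ hq
    have : q ∈ s := (Finset.mem_product.1 hq).1
    simp only [s, Finset.mem_filter, Finset.mem_univ, true_and] at this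
    cases b
    exacts [this.2.1, this.2.2]
  set w := x \ (s ×ˢ Finset.univ)
  have hcard : ∀ t : Finset (Fin r), (t ×ˢ (Finset.univ : Finset Bool)).card = 2 * t.card := by
    intro t
    simp [Finset.card_product, mul_comm]
  have hpw : ∀ t : Finset (Fin r), planeWt (t ×ˢ (Finset.univ : Finset Bool)) =
      2 * ∑ q ∈ t, 2 ^ (q : ℕ) := by
    intro t
    simp [planeWt, Finset.sum_product, Finset.mul_sum, two_mul]
  have hnd : ∀ t : Finset (Fin r), Disjoint (t ×ˢ (Finset.univ : Finset Bool)) w →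
      (planeList t ++ w.toList).Nodup := by
    intro t ht
    rw [List.nodup_append]
    refine ⟨nodup_planeList t, w.nodup_toList, fun a ha b hb hab => ?_⟩
    refine Finset.disjoint_left.1 ht (show a ∈ _ from ?_) ?_
    · simpa using mem_planeList.1 ha
    · rw [hab]; simpa using hb
  have htf : ∀ t : Finset (Fin r), (planeList t ++ w.toList).toFinset =
      t ×ˢ (Finset.univ : Finset Bool) ∪ w := by
    intro t
    rw [List.toFinset_append, toFinset_planeList, Finset.toList_toFinset]
  have hlt : ∀ t ⊆ sᶜ, t.card = s.card → Disjoint (t ×ˢ (Finset.univ : Finset Bool)) w →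
      ∑ q ∈ s, 2 ^ (q : ℕ) < ∑ q ∈ t, 2 ^ (q : ℕ) := by
    intro t hts htc hd
    have hsp : ∑ q ∈ s, 2 ^ (q : ℕ) < 2 ^ p := by
      have := Nat.geomSum_lt le_rfl (n := p) (s := s.map Fin.valEmbedding)
        (by rintro k hk; obtain ⟨q, hq, rfl⟩ := Finset.mem_map.1 hk; exact (Finset.mem_filter.1 hq).2.1)
      simpa using this
    by_cases ht : ∃ q ∈ t, p ≤ (q : ℕ)
    · obtain ⟨q, hq, hpq⟩ := ht
      calc _ < 2 ^ p := hsp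
        _ ≤ 2 ^ (q : ℕ) := Nat.pow_le_pow_right two_pos hpq
        _ ≤ _ := Finset.single_le_sum (f := fun q : Fin r => 2 ^ (q : ℕ)) (by simp) hq
    · exfalso
      push Not at ht
      set wp := w.filter fun i => (i.1 : ℕ) < p
      have hxp : (x.filter fun i => (i.1 : ℕ) < p).card = 2 * s.card + wp.card := by
        rw [← Finset.union_sdiff_of_subset hsx, Finset.filter_union, Finset.card_union_of_disjoint
          (Finset.disjoint_filter_filter Finset.disjoint_sdiff), ← hcard]
        congr 2
        refine Finset.filter_true_of_mem fun i hi => ?_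
        have : i.1 ∈ s := (Finset.mem_product.1 hi).1
        simp only [s, Finset.mem_filter] at this
        exact this.2.1
      have hw : (wp.image Prod.fst).card = wp.card := by
        refine Finset.card_image_of_injOn ?_
        rintro ⟨q, b⟩ hq ⟨q', b'⟩ hq' (rfl : q = q')
        by_contra hne
        simp only [wp, w, s, Finset.coe_filter, Finset.mem_sdiff, Finset.mem_product,
          Finset.mem_filter, Finset.mem_univ, true_and, and_true, Set.mem_ofPred_eq] at hq hq'
        cases b <;> cases b' <;> simp_all
      have hst : Disjoint s t := (Finset.subset_compl_iff_disjoint_left.1 hts)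
      have hdw : Disjoint (s ∪ t) (wp.image Prod.fst) := by
        rw [Finset.disjoint_left]
        intro q hq hq'
        obtain ⟨i, hi, rfl⟩ := Finset.mem_image.1 hq'
        have hiw : i ∈ w := (Finset.mem_filter.1 hi).1
        rcases Finset.mem_union.1 hq with h | h
        · exact (Finset.mem_sdiff.1 hiw).2 (by simpa using h)
        · exact Finset.disjoint_left.1 hd (show i ∈ _ by simpa using h) hiw
      have hle : (s ∪ t ∪ wp.image Prod.fst).card ≤ p := by
        rw [← Finset.card_map Fin.valEmbedding, ← Finset.card_range p]
        refine Finset.card_le_card fun k hk => ?_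
        obtain ⟨q, hq, rfl⟩ := Finset.mem_map.1 hk
        rw [Finset.mem_range]
        rcases Finset.mem_union.1 hq with hq | hq
        · rcases Finset.mem_union.1 hq with hq | hq
          · simp only [s, Finset.mem_filter] at hq
            exact hq.2.1
          · exact ht q hq
        · obtain ⟨i, hi, rfl⟩ := Finset.mem_image.1 hq
          exact (Finset.mem_filter.1 hi).2
      rw [Finset.card_union_of_disjoint hdw, Finset.card_union_of_disjoint hst, hw] at hle
      omega
  have hmem : ∀ t ∈ sᶜ.powersetCard s.card, pfl y (planeList t ++ w.toList) ∈ K := by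
    intro t ht
    rw [Finset.mem_powersetCard] at ht
    by_cases hd : Disjoint (t ×ˢ (Finset.univ : Finset Bool)) w
    swap
    · rw [pfl_eq_zero_of_not_nodup hy.alt]
      · exact K.zero_mem
      · intro h
        apply hd
        rw [Finset.disjoint_left]
        intro a ha hb
        exact (List.nodup_append.1 h).2.2 a (mem_planeList.2 (Finset.mem_product.1 ha).1) a
          (by simpa using hb) rfl
    have hin : pfs y (t ×ˢ (Finset.univ : Finset Bool) ∪ w) ∈ K := by
      refine hK _ ?_ ?_
      · rw [Finset.card_union_of_disjoint hd, hcard, ht.2, ← hcard,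
          ← Finset.card_union_of_disjoint Finset.disjoint_sdiff, Finset.union_sdiff_of_subset hsx]
      · have hsum : planeWt x = planeWt (s ×ˢ (Finset.univ : Finset Bool)) + planeWt w := by
          rw [planeWt, planeWt, planeWt, ← Finset.sum_union Finset.disjoint_sdiff,
            Finset.union_sdiff_of_subset hsx]
        rw [hsum, planeWt_union hd, hpw, hpw]
        gcongr ?_ * ?_ + _
        exact hlt t ht.1 ht.2 hd
    rcases pfl_eq_pfs hy.alt (hnd t hd) with h | h <;> rw [h, htf]
    exacts [hin, K.neg_mem hin]
  have hsum : pfl y (planeList s ++ w.toList) ∈ K := by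
    rw [pfl_planeList_append hy _ _ (hunit _ (by simpa using s.card_le_univ))]
    rcases neg_one_pow_eq_or S s.card with h | h
    · rw [h, one_mul]
      exact K.sum_mem hmem
    · rw [h, neg_one_mul]
      exact K.neg_mem (K.sum_mem hmem)
  have hx' : (planeList s ++ w.toList).toFinset = x := by
    rw [htf, Finset.union_sdiff_of_subset hsx]
  rcases pfl_eq_pfs hy.alt (hnd s Finset.disjoint_sdiff) with h | h <;> rw [h, hx'] at hsum
  exacts [hsum, by simpa using K.neg_mem hsum]

end Symplectic

section Straightening

variable {r : ℕ}

/-- The position of an index in the order `0̄, 0, 1̄, 1, …`. -/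
def idxPos (i : Fin r × Bool) : ℕ := 2 * i.1 + i.2.toNat

theorem idxPos_lt (i : Fin r × Bool) : idxPos i < 2 * r := by
  have h1 := i.1.isLt
  have h2 := i.2.toNat_le
  rw [idxPos]
  omega

theorem idxPos_injective : Function.Injective (idxPos (r := r)) := by
  rintro ⟨p, b⟩ ⟨q, c⟩ h
  cases b <;> cases c <;> simp [idxPos] at h ⊢ <;> omega

/-- The symplectic condition on a row. -/
def IsSymplecticRow (x : Finset (Fin r × Bool)) : Prop :=
  ∀ p, (x.filter fun i => (i.1 : ℕ) < p).card ≤ p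

/-- Symplectic standard even-tableaux, as multisets of rows. -/
structure IsStdTab (T : Multiset (Finset (Fin r × Bool))) : Prop where
  nonempty : ∀ x ∈ T, x ≠ ∅
  even : ∀ x ∈ T, Even x.card
  symplectic : ∀ x ∈ T, IsSymplecticRow x
  chain : ∀ x ∈ T, ∀ z ∈ T, (∀ a, cnt idxPos z a ≤ cnt idxPos x a) ∨
    ∀ a, cnt idxPos x a ≤ cnt idxPos z a

variable {S : Type*} [CommRing S]

/-- The product of the Pfaffians of the rows of `T`. -/
def tabProd (y : Matrix (Fin r × Bool) (Fin r × Bool) S)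
    (T : Multiset (Finset (Fin r × Bool))) : S :=
  (T.map (pfs y)).prod

theorem tabProd_cons (y : Matrix (Fin r × Bool) (Fin r × Bool) S) (x : Finset (Fin r × Bool))
    (T : Multiset (Finset (Fin r × Bool))) : tabProd y (x ::ₘ T) = pfs y x * tabProd y T := by
  simp [tabProd]

/-- The sum of the weights of a row. -/
def rowWt (x : Finset (Fin r × Bool)) : ℕ := ∑ i ∈ x, wt idxPos (2 * r) i

/-- The quantity increased by both straightening moves. -/
def potential (d : ℕ) (T : Multiset (Finset (Fin r × Bool))) : ℕ :=
  (T.map planeWt).sum * (d * rowWt (Finset.univ : Finset (Fin r × Bool)) ^ 2 + 1) +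
    (T.map fun x => rowWt x ^ 2).sum

theorem sum_map_rowWt_le (T : Multiset (Finset (Fin r × Bool))) :
    (T.map fun x => rowWt x ^ 2).sum ≤
      T.card * rowWt (Finset.univ : Finset (Fin r × Bool)) ^ 2 := by
  have := Multiset.sum_le_card_nsmul (T.map fun x => rowWt x ^ 2)
    (rowWt (Finset.univ : Finset (Fin r × Bool)) ^ 2) (by
      intro n hn
      obtain ⟨x, -, rfl⟩ := Multiset.mem_map.1 hn
      exact Nat.pow_le_pow_left (Finset.sum_le_sum_of_subset (Finset.subset_univ x)) 2)
  simpa using this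

theorem potential_le (T : Multiset (Finset (Fin r × Bool))) :
    potential T.card T ≤ T.card * planeWt (Finset.univ : Finset (Fin r × Bool)) *
      (T.card * rowWt (Finset.univ : Finset (Fin r × Bool)) ^ 2 + 1) +
      T.card * rowWt (Finset.univ : Finset (Fin r × Bool)) ^ 2 := by
  have := Multiset.sum_le_card_nsmul (T.map planeWt)
    (planeWt (Finset.univ : Finset (Fin r × Bool))) (by
      intro n hn
      obtain ⟨x, -, rfl⟩ := Multiset.mem_map.1 hn
      exact Finset.sum_le_sum_of_subset (Finset.subset_univ x))
  rw [Multiset.card_map, smul_eq_mul] at this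
  exact Nat.add_le_add (Nat.mul_le_mul_right _ this) (sum_map_rowWt_le T)

theorem potential_lt_of_planeWt_lt {x x' : Finset (Fin r × Bool)}
    (T : Multiset (Finset (Fin r × Bool))) (h : planeWt x < planeWt x') :
    potential (T.card + 1) (x ::ₘ T) < potential (T.card + 1) (x' ::ₘ T) := by
  have h1 := sum_map_rowWt_le (x ::ₘ T)
  simp only [potential, Multiset.map_cons, Multiset.sum_cons, Multiset.card_cons] at h1 ⊢
  generalize (T.card + 1) * rowWt (Finset.univ : Finset (Fin r × Bool)) ^ 2 = N at *
  have h2 := Nat.mul_le_mul_right (N + 1) (show planeWt x + (T.map planeWt).sum + 1 ≤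
    planeWt x' + (T.map planeWt).sum by omega)
  rw [add_mul, one_mul] at h2
  omega

theorem potential_lt_of_rowWt_lt {x z x' z' : Finset (Fin r × Bool)} (d : ℕ)
    (T : Multiset (Finset (Fin r × Bool))) (hzx : rowWt z ≤ rowWt x) (h : rowWt x < rowWt x')
    (hf : ∀ f : Fin r × Bool → ℕ, ∑ i ∈ x', f i + ∑ i ∈ z', f i = ∑ i ∈ x, f i + ∑ i ∈ z, f i) :
    potential d (x ::ₘ z ::ₘ T) < potential d (x' ::ₘ z' ::ₘ T) := by
  have h1 : planeWt x' + planeWt z' = planeWt x + planeWt z := hf _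
  have h2 : rowWt x' + rowWt z' = rowWt x + rowWt z := hf _
  simp only [potential, Multiset.map_cons, Multiset.sum_cons, ← add_assoc, h1]
  have : rowWt x ^ 2 + rowWt z ^ 2 < rowWt x' ^ 2 + rowWt z' ^ 2 := by
    zify at *
    nlinarith
  omega

variable {y : Matrix (Fin r × Bool) (Fin r × Bool) S} {F : Type*} [CommRing F] [Algebra F S]

theorem tabProd_mem_span (hy : IsIsotropic y) (hunit : ∀ g ≤ r, IsUnit (g.factorial : S))
    (T : Multiset (Finset (Fin r × Bool))) (hT : ∀ x ∈ T, Even x.card) :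
    tabProd y T ∈ Submodule.span F (tabProd y '' {T | IsStdTab T}) := by
  set M := Submodule.span F (tabProd y '' {T | IsStdTab T})
  suffices ∀ d n, ∀ T : Multiset (Finset (Fin r × Bool)), T.card = d →
      d * planeWt (Finset.univ : Finset (Fin r × Bool)) *
      (d * rowWt (Finset.univ : Finset (Fin r × Bool)) ^ 2 + 1) +
      d * rowWt (Finset.univ : Finset (Fin r × Bool)) ^ 2 - potential d T = n →
      (∀ x ∈ T, Even x.card) → tabProd y T ∈ M from this _ _ T rfl rfl hT
  clear T hT
  intro d n
  induction n using Nat.strong_induction_on with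
  | _ n ih =>
  intro T hd hn hT
  replace ih : ∀ T' : Multiset (Finset (Fin r × Bool)), T'.card = d →
      potential d T < potential d T' → (∀ x ∈ T', Even x.card) → tabProd y T' ∈ M := by
    intro T' hd' hlt hT'
    refine ih _ ?_ T' hd' rfl hT'
    have := potential_le T'
    rw [hd'] at this
    omega
  let K : S → AddSubgroup S := fun c => M.toAddSubgroup.comap (AddMonoidHom.mulRight c)
  have hK : ∀ a c, a ∈ K c ↔ a * c ∈ M := fun a c => Iff.rfl
  by_cases hs : ∀ x ∈ T, IsSymplecticRow x
  swap
  · push Not at hs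
    obtain ⟨x, hxT, hx⟩ := hs
    obtain ⟨T, rfl⟩ := Multiset.exists_cons_of_mem hxT
    simp only [IsSymplecticRow, not_forall, not_le] at hx
    obtain ⟨p, hp⟩ := hx
    rw [tabProd_cons, ← hK]
    refine pfs_mem_of_not_symplectic hy hunit hp _ fun x' hc hlt => ?_
    rw [hK, ← tabProd_cons]
    refine ih _ (by simpa using hd) ?_ ?_
    · rw [Multiset.card_cons] at hd
      rw [← hd]
      exact potential_lt_of_planeWt_lt T hlt
    · intro z hz
      rcases Multiset.mem_cons.1 hz with rfl | hz
      · rw [hc]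
        exact hT x hxT
      · exact hT z (Multiset.mem_cons_of_mem hz)
  by_cases hc : ∀ x ∈ T, ∀ z ∈ T, (∀ a, cnt idxPos z a ≤ cnt idxPos x a) ∨
      ∀ a, cnt idxPos x a ≤ cnt idxPos z a
  swap
  · push Not at hc
    obtain ⟨x, hxT, z, hzT, ha, hb⟩ := hc
    wlog hv : rowWt z ≤ rowWt x generalizing x z
    · exact this z hzT x hxT hb ha (le_of_not_ge hv)
    obtain ⟨a, ha⟩ := ha
    obtain ⟨T, rfl⟩ := Multiset.exists_cons_of_mem hxT
    rcases Multiset.mem_cons.1 hzT with rfl | hzT'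
    · exact absurd ha (lt_irrefl _)
    obtain ⟨T, rfl⟩ := Multiset.exists_cons_of_mem hzT'
    rw [tabProd_cons, tabProd_cons, ← mul_assoc, ← hK]
    refine pfs_mul_mem_of_cnt_lt hy.alt idxPos_lt (hT x hxT) (hT z hzT) hv ha _
      fun x' z' hx' hz' hf hlt => ?_
    rw [hK, mul_assoc, ← tabProd_cons, ← tabProd_cons]
    refine ih _ (by simpa using hd) (potential_lt_of_rowWt_lt d T hv hlt hf) ?_
    intro w hw
    rcases Multiset.mem_cons.1 hw with rfl | hw
    · exact hx'
    rcases Multiset.mem_cons.1 hw with rfl | hw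
    · exact hz'
    · exact hT w (by simp [hw])
  have hne : tabProd y (T.filter (· ≠ ∅)) = tabProd y T := by
    have h1 : ((T.filter (¬ · ≠ ∅)).map (pfs y)).prod = 1 := by
      refine Multiset.prod_eq_one fun a ha => ?_
      obtain ⟨x, hx, rfl⟩ := Multiset.mem_map.1 ha
      obtain rfl : x = ∅ := by simpa using (Multiset.mem_filter.1 hx).2
      simp [pfs, pfl_nil]
    conv_rhs => rw [tabProd, ← Multiset.filter_add_not (· ≠ ∅) T, Multiset.map_add,
      Multiset.prod_add, h1, mul_one]
    rfl
  rw [← hne]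
  refine Submodule.subset_span ⟨_, ⟨?_, ?_, ?_, ?_⟩, rfl⟩
  · exact fun x hx => (Multiset.mem_filter.1 hx).2
  · exact fun x hx => hT x (Multiset.mem_filter.1 hx).1
  · exact fun x hx => hs x (Multiset.mem_filter.1 hx).1
  · exact fun x hx z hz => hc x (Multiset.mem_filter.1 hx).1 z (Multiset.mem_filter.1 hz).1

theorem mul_mem_span_tabProd (hy : IsIsotropic y) (hunit : ∀ g ≤ r, IsUnit (g.factorial : S))
    {a : S} (ha : a ∈ Submodule.span F (tabProd y '' {T | IsStdTab T})) (i j : Fin r × Bool) :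
    a * y i j ∈ Submodule.span F (tabProd y '' {T | IsStdTab T}) := by
  have hspan := tabProd_mem_span (F := F) hy hunit
  set M := Submodule.span F (tabProd y '' {T | IsStdTab T})
  induction ha using Submodule.span_induction with
  | mem a ha =>
    obtain ⟨T, hT, rfl⟩ := ha
    by_cases hij : i = j
    · rw [hij, hy.alt.1, mul_zero]
      exact M.zero_mem
    have h1 := hspan (({i, j} : Finset (Fin r × Bool)) ::ₘ T) (by
      intro x hx
      rcases Multiset.mem_cons.1 hx with rfl | hx
      · rw [Finset.card_pair hij]
        exact even_two
      · exact hT.even x hx)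
    rw [tabProd_cons, mul_comm] at h1
    have h2 := pfl_eq_pfs hy.alt (l := [i, j]) (by simp [hij])
    rw [pfl_pair, List.toFinset_cons, List.toFinset_cons, List.toFinset_nil,
      insert_empty_eq] at h2
    rcases h2 with h | h <;> rw [h]
    · exact h1
    · rw [mul_neg]
      exact M.neg_mem h1
  | zero => rw [zero_mul]; exact M.zero_mem
  | add a b _ _ iha ihb => rw [add_mul]; exact M.add_mem iha ihb
  | smul c a _ iha => rw [smul_mul_assoc]; exact M.smul_mem c iha

end Straightening

section CoordinateRing

variable {r : ℕ}

/-- The index `(p, false)` is the barred `p`, the index `(p, true)` is the unbarred one. -/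
def idx (i : Fin r × Bool) : Fin (2 * r) := if i.2 then emb r i.1 else embBar r i.1

theorem idx_bijective : Function.Bijective (idx (r := r)) := by
  constructor
  · rintro ⟨p, b⟩ ⟨q, c⟩ h
    cases b <;> cases c <;> simp [idx, emb, embBar, Fin.ext_iff] at h ⊢ <;> omega
  · intro a
    by_cases h : a.val < r
    · exact ⟨(⟨a, h⟩, true), by simp [idx, emb]⟩
    · exact ⟨(⟨a - r, by omega⟩, false), by simp [idx, embBar, Fin.ext_iff]; omega⟩

theorem sum_eq_sum_emb {S : Type*} [AddCommMonoid S] (f : Fin (2 * r) → S) :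
    ∑ a, f a = ∑ p : Fin r, (f (emb r p) + f (embBar r p)) := by
  rw [← idx_bijective.sum_comp, Fintype.sum_prod_type]
  simp [idx]

theorem Jmat_map {S S' : Type*} [CommRing S] [CommRing S'] (φ : S →+* S') :
    (Jmat r S).map φ = Jmat r S' := by
  ext i j
  simp only [Jmat, Matrix.map_apply, Matrix.of_apply]
  split_ifs <;> simp

theorem Jmat_mul_emb {S : Type*} [CommRing S] (Y : Matrix (Fin (2 * r)) (Fin (2 * r)) S)
    (p : Fin r) (j : Fin (2 * r)) : (Jmat r S * Y) (emb r p) j = Y (embBar r p) j := by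
  rw [Matrix.mul_apply, Finset.sum_eq_single (embBar r p)]
  · simp [Jmat, emb, embBar, add_comm]
  · intro b _ hb
    have h1 : ¬ (b : ℕ) = (p : ℕ) + r := fun h => hb (by ext; simp [embBar, h, add_comm])
    have h2 : ¬ (p : ℕ) = (b : ℕ) + r := by omega
    simp [Jmat, emb, h1, h2]
  · simp

theorem Jmat_mul_embBar {S : Type*} [CommRing S] (Y : Matrix (Fin (2 * r)) (Fin (2 * r)) S)
    (p : Fin r) (j : Fin (2 * r)) : (Jmat r S * Y) (embBar r p) j = -Y (emb r p) j := by
  rw [Matrix.mul_apply, Finset.sum_eq_single (emb r p)]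
  · have h1 : ¬ (p : ℕ) = r + (r + (p : ℕ)) := by have := p.isLt; omega
    simp [Jmat, emb, embBar, add_comm, h1]
  · intro b _ hb
    have h1 : ¬ r + (p : ℕ) = (b : ℕ) + r := fun h => hb (by ext; simp only [emb]; omega)
    have h2 : ¬ (b : ℕ) = r + (p : ℕ) + r := by omega
    simp [Jmat, embBar, h1, h2]
  · simp

theorem transpose_mul_Jmat_mul {S : Type*} [CommRing S]
    (Y : Matrix (Fin (2 * r)) (Fin (2 * r)) S) (i j : Fin (2 * r)) :
    (Yᵀ * Jmat r S * Y) i j =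
      ∑ p : Fin r, (Y (emb r p) i * Y (embBar r p) j - Y (embBar r p) i * Y (emb r p) j) := by
  rw [Matrix.mul_assoc, Matrix.mul_apply, sum_eq_sum_emb]
  simp [Jmat_mul_emb, Jmat_mul_embBar, sub_eq_add_neg]

theorem MemV.isIsotropic {S : Type*} [CommRing S] {Y : Matrix (Fin (2 * r)) (Fin (2 * r)) S}
    (hY : MemV r Y) (h2 : IsUnit (2 : S)) : IsIsotropic (Y.submatrix idx idx) := by
  obtain ⟨hanti, hdiag, hiso, hchar⟩ := hY
  have hanti' : ∀ i j, Y i j = -Y j i := fun i j => congrFun (congrFun hanti i) j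
  refine ⟨⟨fun i => hdiag _, fun i j => hanti' _ _⟩, ?_, ?_⟩
  · rcases Nat.eq_zero_or_pos r with rfl | hr
    · simp
    rcases subsingleton_or_nontrivial S with hS | hS
    · exact Subsingleton.elim _ _
    have : Nonempty (Fin (2 * r)) := ⟨⟨0, by omega⟩⟩
    have h := Matrix.trace_eq_neg_charpoly_coeff (-(Jmat r S * Y))
    rw [hchar, Polynomial.coeff_X_pow, if_neg (by rw [Fintype.card_fin]; omega), neg_zero,
      Matrix.trace_neg, neg_eq_zero, Matrix.trace, sum_eq_sum_emb] at h
    simp only [Matrix.diag_apply, Jmat_mul_emb, Jmat_mul_embBar] at h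
    apply h2.mul_left_cancel
    rw [mul_zero, ← h, Finset.mul_sum]
    refine Finset.sum_congr rfl fun p _ => ?_
    rw [hanti' (emb r p)]
    simp [idx, two_mul]
  · intro i j
    have := transpose_mul_Jmat_mul Y (idx i) (idx j)
    rw [hiso] at this
    simpa [idx] using this.symm

theorem memV_of_isotropic {S : Type*} [CommRing S] [IsDomain S]
    {Y : Matrix (Fin (2 * r)) (Fin (2 * r)) S} (hY : IsAltMat Y)
    (hiso : ∀ i j, ∑ p : Fin r,
      (Y (emb r p) i * Y (embBar r p) j - Y (embBar r p) i * Y (emb r p) j) = 0) : MemV r Y := by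
  have hiso' : Yᵀ * Jmat r S * Y = 0 := by
    ext i j
    rw [transpose_mul_Jmat_mul, hiso, Matrix.zero_apply]
  have hanti : Yᵀ = -Y := by
    ext i j
    simp [hY.2 j i]
  refine ⟨by rw [hanti, neg_neg], hY.1, hiso', ?_⟩
  have hsq : (-(Jmat r S * Y)) ^ 2 = 0 := by
    rw [hanti] at hiso'
    rw [neg_sq, pow_two, Matrix.mul_assoc, ← Matrix.mul_assoc Y]
    have : Y * Jmat r S * Y = 0 := by simpa using hiso'
    rw [this, Matrix.mul_zero]
  have := Matrix.isNilpotent_charpoly_sub_pow_of_isNilpotent ⟨2, hsq⟩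
  simpa [sub_eq_zero] using this.eq_zero

variable (F : Type*) [Field F]

theorem VIdeal_le_ker {S : Type*} [CommRing S] [Algebra F S]
    {Y : Matrix (Fin (2 * r)) (Fin (2 * r)) S} (hY : MemV r Y) :
    VIdeal r F ≤ RingHom.ker (MvPolynomial.aeval fun q : Fin (2 * r) × Fin (2 * r) =>
      Y q.1 q.2 : PolyRing r F →ₐ[F] S) := by
  set φ : PolyRing r F →ₐ[F] S := MvPolynomial.aeval fun q => Y q.1 q.2
  have hφ : (Ygen r F).map φ = Y := by
    ext i j
    simp [Ygen, φ]
  obtain ⟨hanti, hdiag, hiso, hchar⟩ := hY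
  rw [VIdeal, Ideal.span_le]
  rintro p (((⟨i, j, rfl⟩ | ⟨i, rfl⟩) | ⟨i, j, rfl⟩) | ⟨k, rfl⟩)
  · have := congrFun (congrFun hanti i) j
    simp only [Matrix.neg_apply, Matrix.transpose_apply] at this
    simp [Ygen, φ, this]
  · simp [Ygen, φ, hdiag]
  · have : ((Ygen r F)ᵀ * Jmat r (PolyRing r F) * Ygen r F).map φ = 0 := by
      rw [Matrix.map_mul, Matrix.map_mul, Matrix.transpose_map, hφ]
      exact (congrArg (fun J => Yᵀ * J * Y) (Jmat_map φ.toRingHom)).trans hiso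
    exact congrFun (congrFun this i) j
  · have : (-(Jmat r (PolyRing r F) * Ygen r F)).map φ.toRingHom = -(Jmat r S * Y) := by
      rw [← Jmat_map φ.toRingHom, ← hφ]
      ext i j
      simp [Matrix.mul_apply]
    have h := Matrix.charpoly_map (-(Jmat r (PolyRing r F) * Ygen r F)) φ.toRingHom
    rw [this, hchar] at h
    have h' := congrArg (Polynomial.coeff · k) h
    simp only [Polynomial.coeff_map] at h'
    change φ _ = 0
    rw [Polynomial.coeff_sub, map_sub, sub_eq_zero]
    refine h'.symm.trans ?_
    simp only [Polynomial.coeff_X_pow]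
    split_ifs <;> simp

/-- The generic point of `V`. -/
def genericPoint (r : ℕ) : Matrix (Fin (2 * r)) (Fin (2 * r)) (FV r F) :=
  (Ygen r F).map (Ideal.Quotient.mk (VIdeal r F))

theorem memV_map {S : Type*} [CommRing S] (φ : PolyRing r F →+* S)
    (hφ : VIdeal r F ≤ RingHom.ker φ) : MemV r ((Ygen r F).map φ) := by
  have hmap : ∀ M : Matrix (Fin (2 * r)) (Fin (2 * r)) (PolyRing r F),
      (Jmat r (PolyRing r F) * M).map φ = Jmat r S * M.map φ := by
    intro M
    rw [Matrix.map_mul, Jmat_map φ]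
  refine ⟨?_, ?_, ?_, ?_⟩
  · ext i j
    have : φ _ = 0 := hφ (Ideal.subset_span (.inl (.inl (.inl ⟨i, j, rfl⟩))))
    rw [Matrix.add_apply, map_add] at this
    exact eq_neg_of_add_eq_zero_left this
  · exact fun i => hφ (Ideal.subset_span (.inl (.inl (.inr ⟨i, rfl⟩))))
  · ext i j
    have : φ _ = 0 := hφ (Ideal.subset_span (.inl (.inr ⟨i, j, rfl⟩)))
    rw [Matrix.mul_assoc, ← hmap, ← Matrix.transpose_map, ← Matrix.map_mul, ← Matrix.mul_assoc]
    exact this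
  · have h1 : -(Jmat r S * (Ygen r F).map φ) =
        (-(Jmat r (PolyRing r F) * Ygen r F)).map φ := by
      rw [← hmap]
      ext i j
      exact (map_neg φ _).symm
    rw [h1, Matrix.charpoly_map]
    ext k
    have : φ _ = 0 := hφ (Ideal.subset_span (.inr ⟨k, rfl⟩))
    rw [Polynomial.coeff_sub, map_sub, sub_eq_zero] at this
    rw [Polynomial.coeff_map, this]
    simp only [Polynomial.coeff_X_pow]
    split_ifs <;> simp

theorem memV_genericPoint : MemV r (genericPoint F r) :=
  memV_map F (Ideal.Quotient.mk (VIdeal r F)) (Ideal.mk_ker (I := VIdeal r F)).ge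

theorem isUnit_factorial_of_ringChar (hchar : ringChar F = 0 ∨ r < ringChar F) {g : ℕ}
    (hg : g ≤ r) : IsUnit (g.factorial : F) := by
  rw [isUnit_iff_ne_zero]
  rcases hchar with h | h
  · have : CharZero F := by
      rw [← CharP.ringChar_zero_iff_CharZero]
      exact h
    exact_mod_cast g.factorial_ne_zero
  · rw [Ne, ringChar.spec]
    have hp : (ringChar F).Prime := by
      rcases CharP.char_is_prime_or_zero F (ringChar F) with hp | hp
      · exact hp
      · omega
    rw [hp.dvd_factorial]
    omega

theorem span_tabProd_eq_top (hr : Even r) (hchar : ringChar F = 0 ∨ r < ringChar F) :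
    Submodule.span F (tabProd ((genericPoint F r).submatrix idx idx) '' {T | IsStdTab T}) = ⊤ := by
  set y := (genericPoint F r).submatrix idx idx
  have hunit : ∀ g ≤ r, IsUnit (g.factorial : FV r F) := by
    intro g hg
    have := (isUnit_factorial_of_ringChar F hchar hg).map (algebraMap F (FV r F))
    simpa using this
  have hy : IsIsotropic y := by
    rcases Nat.lt_or_ge r 2 with h | h
    · obtain rfl : r = 0 := by
        obtain ⟨k, hk⟩ := hr
        omega
      exact ⟨⟨fun i => i.1.elim0, fun i => i.1.elim0⟩, by simp, fun i => i.1.elim0⟩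
    · exact (memV_genericPoint F).isIsotropic (by simpa using hunit 2 h)
  have hspan := tabProd_mem_span (F := F) hy hunit
  set M := Submodule.span F (tabProd y '' {T | IsStdTab T})
  have hmul := fun a (ha : a ∈ M) => mul_mem_span_tabProd (F := F) hy hunit ha
  rw [eq_top_iff]
  intro a _
  obtain ⟨p, rfl⟩ := Ideal.Quotient.mk_surjective a
  induction p using MvPolynomial.induction_on with
  | C c =>
    have h := hspan 0 (by simp)
    have := M.smul_mem c h
    rw [tabProd, Multiset.map_zero, Multiset.prod_zero] at this
    exact (Algebra.algebraMap_eq_smul_one (A := FV r F) c).symm ▸ this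
  | add p q hp hq => rw [map_add]; exact M.add_mem (hp trivial) (hq trivial)
  | mul_X p q hp =>
    obtain ⟨i, hi⟩ := idx_bijective.2 q.1
    obtain ⟨j, hj⟩ := idx_bijective.2 q.2
    have := hmul _ (hp trivial) i j
    rw [map_mul]
    convert this
    simp [y, genericPoint, Ygen, hi, hj]

end CoordinateRing

section Chains

variable {r : ℕ}

theorem card_filter_idxPos_le (x : Finset (Fin r × Bool)) (i : Fin r × Bool) :
    cnt idxPos x (idxPos i) =
      (x.filter (idxPos · < idxPos i)).card + if i ∈ x then 1 else 0 := by
  have h : x.filter (idxPos · ≤ idxPos i) =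
      x.filter (idxPos · < idxPos i) ∪ x.filter (· = i) := by
    ext j
    simp only [Finset.mem_filter, Finset.mem_union, ← idxPos_injective.eq_iff (a := j)]
    rw [le_iff_lt_or_eq]
    tauto
  rw [cnt, h, Finset.card_union_of_disjoint, Finset.filter_eq']
  · split_ifs <;> simp
  · rw [Finset.disjoint_left]
    intro j hj hj'
    rw [Finset.mem_filter] at hj hj'
    rw [hj'.2] at hj
    exact lt_irrefl _ hj.2

theorem eq_of_cnt_eq {x z : Finset (Fin r × Bool)}
    (h : ∀ a, cnt idxPos x a = cnt idxPos z a) : x = z := by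
  ext i
  have h1 := h (idxPos i)
  have h2 : (x.filter (idxPos · < idxPos i)).card = (z.filter (idxPos · < idxPos i)).card := by
    rcases Nat.eq_zero_or_pos (idxPos i) with h0 | h0
    · simp [h0]
    · have := h (idxPos i - 1)
      simpa only [cnt, Nat.le_sub_one_iff_lt h0] using this
  rw [card_filter_idxPos_le, card_filter_idxPos_le, h2] at h1
  by_cases hx : i ∈ x <;> by_cases hz : i ∈ z <;> simp_all

theorem exists_cnt_max {T : Multiset (Finset (Fin r × Bool))} (hne : T ≠ 0)
    (hT : ∀ x ∈ T, ∀ z ∈ T, (∀ a, cnt idxPos z a ≤ cnt idxPos x a) ∨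
      ∀ a, cnt idxPos x a ≤ cnt idxPos z a) :
    ∃ x ∈ T, ∀ z ∈ T, ∀ a, cnt idxPos z a ≤ cnt idxPos x a := by
  induction T using Multiset.induction with
  | empty => exact absurd rfl hne
  | cons x T ih =>
    rcases eq_or_ne T 0 with rfl | h0
    · exact ⟨x, by simp, by simp⟩
    obtain ⟨m, hm, hmax⟩ := ih h0 fun x hx z hz =>
      hT x (Multiset.mem_cons_of_mem hx) z (Multiset.mem_cons_of_mem hz)
    rcases hT x (Multiset.mem_cons_self x T) m (Multiset.mem_cons_of_mem hm) with h | h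
    · refine ⟨x, Multiset.mem_cons_self x T, fun z hz a => ?_⟩
      rcases Multiset.mem_cons.1 hz with rfl | hz
      · exact le_rfl
      · exact (hmax z hz a).trans (h a)
    · refine ⟨m, Multiset.mem_cons_of_mem hm, fun z hz a => ?_⟩
      rcases Multiset.mem_cons.1 hz with rfl | hz
      · exact h a
      · exact hmax z hz a

theorem IsStdTab.of_cons {x : Finset (Fin r × Bool)} {T : Multiset (Finset (Fin r × Bool))}
    (h : IsStdTab (x ::ₘ T)) : IsStdTab T where
  nonempty z hz := h.nonempty z (Multiset.mem_cons_of_mem hz)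
  even z hz := h.even z (Multiset.mem_cons_of_mem hz)
  symplectic z hz := h.symplectic z (Multiset.mem_cons_of_mem hz)
  chain z hz w hw := h.chain z (Multiset.mem_cons_of_mem hz) w (Multiset.mem_cons_of_mem hw)

theorem IsStdTab.eq_zero_of_countP {T : Multiset (Finset (Fin r × Bool))} (hT : IsStdTab T)
    (h : ∀ a k, T.countP (fun x => k < cnt idxPos x a) = 0) : T = 0 := by
  by_contra hne
  obtain ⟨x, hx⟩ := Multiset.exists_mem_of_ne_zero hne
  obtain ⟨i, hi⟩ := Finset.nonempty_iff_ne_empty.2 (hT.nonempty x hx)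
  refine Multiset.countP_eq_zero.1 (h (idxPos i) 0) x hx (Finset.card_pos.2 ⟨i, ?_⟩)
  simp [hi]

theorem IsStdTab.ext {T U : Multiset (Finset (Fin r × Bool))} (hT : IsStdTab T)
    (hU : IsStdTab U) (h : ∀ a k, T.countP (fun x => k < cnt idxPos x a) =
      U.countP (fun x => k < cnt idxPos x a)) : T = U := by
  induction hn : T.card generalizing T U with
  | zero =>
    rw [Multiset.card_eq_zero] at hn
    subst hn
    exact (hU.eq_zero_of_countP fun a k => by rw [← h, Multiset.countP_zero]).symm
  | succ n ih =>
    have hT0 : T ≠ 0 := by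
      rintro rfl
      simp at hn
    have hU0 : U ≠ 0 := by
      rintro rfl
      exact hT0 (hT.eq_zero_of_countP fun a k => by rw [h, Multiset.countP_zero])
    obtain ⟨x, hx, hxm⟩ := exists_cnt_max hT0 hT.chain
    obtain ⟨z, hz, hzm⟩ := exists_cnt_max hU0 hU.chain
    have hle : ∀ {T U : Multiset (Finset (Fin r × Bool))} {x z : Finset (Fin r × Bool)},
        (∀ a k, T.countP (fun x => k < cnt idxPos x a) =
          U.countP (fun x => k < cnt idxPos x a)) → x ∈ T →
        (∀ w ∈ U, ∀ a, cnt idxPos w a ≤ cnt idxPos z a) →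
        ∀ a, cnt idxPos x a ≤ cnt idxPos z a := by
      intro T U x z h hx hzm a
      by_contra! hlt
      have : 0 < T.countP fun w => cnt idxPos z a < cnt idxPos w a :=
        Multiset.countP_pos.2 ⟨x, hx, hlt⟩
      rw [h, Multiset.countP_pos] at this
      obtain ⟨w, hw, hlt'⟩ := this
      exact absurd (hzm w hw a) (not_le.2 hlt')
    obtain rfl : x = z := eq_of_cnt_eq fun a =>
      le_antisymm (hle h hx hzm a) (hle (fun a k => (h a k).symm) hz hxm a)
    obtain ⟨T, rfl⟩ := Multiset.exists_cons_of_mem hx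
    obtain ⟨U, rfl⟩ := Multiset.exists_cons_of_mem hz
    rw [ih hT.of_cons hU.of_cons (fun a k => ?_) (by simpa using hn)]
    have := h a k
    simpa only [Multiset.countP_cons, Nat.add_right_cancel_iff] using this

theorem exists_enum (x : Finset (Fin r × Bool)) : ∃ g : Fin x.card → Fin r × Bool,
    StrictMono (fun k => idxPos (g k)) ∧ Finset.univ.image g = x := by
  have hc : (x.image idxPos).card = x.card := Finset.card_image_of_injective x idxPos_injective
  have h : ∀ k, ∃ i ∈ x, idxPos i = (x.image idxPos).orderEmbOfFin hc k := fun k =>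
    Finset.mem_image.1 ((x.image idxPos).orderEmbOfFin_mem hc k)
  choose g hg hpos using h
  have hmono : StrictMono (fun k => idxPos (g k)) := by
    intro k l hkl
    simp only [hpos]
    exact ((x.image idxPos).orderEmbOfFin hc).strictMono hkl
  refine ⟨g, hmono, Finset.eq_of_subset_of_card_le ?_ ?_⟩
  · intro i hi
    obtain ⟨k, -, rfl⟩ := Finset.mem_image.1 hi
    exact hg k
  · rw [Finset.card_image_of_injective _ fun k l h => hmono.injective (congrArg idxPos h),
      Finset.card_univ, Fintype.card_fin]

/-- The elements of a row in increasing order. -/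
def enum (x : Finset (Fin r × Bool)) : Fin x.card → Fin r × Bool := (exists_enum x).choose

theorem enum_strictMono (x : Finset (Fin r × Bool)) : StrictMono fun k => idxPos (enum x k) :=
  (exists_enum x).choose_spec.1

theorem image_enum (x : Finset (Fin r × Bool)) : Finset.univ.image (enum x) = x :=
  (exists_enum x).choose_spec.2

theorem enum_injective (x : Finset (Fin r × Bool)) : Function.Injective (enum x) :=
  fun _ _ h => (enum_strictMono x).injective (congrArg idxPos h)

theorem card_filter_eq_card_filter_enum (x : Finset (Fin r × Bool)) (P : Fin r × Bool → Prop)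
    [DecidablePred P] :
    (x.filter P).card = (Finset.univ.filter fun k => P (enum x k)).card := by
  conv_lhs => rw [← image_enum x]
  rw [Finset.filter_image, Finset.card_image_of_injective _ (enum_injective x)]

theorem idxPos_enum_le_iff (x : Finset (Fin r × Bool)) (k : Fin x.card) (a : ℕ) :
    idxPos (enum x k) ≤ a ↔ (k : ℕ) < cnt idxPos x a := by
  rw [cnt, card_filter_eq_card_filter_enum]
  constructor
  · intro h
    calc (k : ℕ) < (Finset.Iic k).card := by simp
      _ ≤ _ := Finset.card_le_card fun l hl => by
        simp only [Finset.mem_filter, Finset.mem_univ, true_and]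
        exact ((enum_strictMono x).monotone (Finset.mem_Iic.1 hl)).trans h
  · intro h
    by_contra hk
    refine absurd h (not_lt.2 ?_)
    calc _ ≤ (Finset.Iio k).card := Finset.card_le_card fun l hl => by
          simp only [Finset.mem_filter, Finset.mem_univ, true_and] at hl
          rw [Finset.mem_Iio]
          by_contra! hkl
          exact hk (((enum_strictMono x).monotone hkl).trans hl)
      _ = k := by simp

theorem IsSymplecticRow.le_enum {x : Finset (Fin r × Bool)} (hx : IsSymplecticRow x)
    (k : Fin x.card) : (k : ℕ) ≤ (enum x k).1 := by
  have h := (idxPos_enum_le_iff x k (2 * (enum x k).1 + 1)).1 (by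
    have := (enum x k).2.toNat_le
    rw [idxPos]
    omega)
  have h2 := hx ((enum x k).1 + 1)
  have h3 : cnt idxPos x (2 * (enum x k).1 + 1) ≤
      (x.filter fun i => (i.1 : ℕ) < (enum x k).1 + 1).card := by
    refine Finset.card_le_card (Finset.monotone_filter_right _ fun i _ hi => ?_)
    rw [idxPos] at hi
    omega
  omega

end Chains

section StandardForm

/-- The entries of the alternating matrix with `2 × 2` diagonal blocks. -/
def stdAlt (a b : ℕ) : ℤ :=
  if Even a ∧ b = a + 1 then 1 else if Even b ∧ a = b + 1 then -1 else 0

theorem stdAlt_self (a : ℕ) : stdAlt a a = 0 := by simp [stdAlt]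

theorem stdAlt_swap (a b : ℕ) : stdAlt a b = -stdAlt b a := by
  rw [stdAlt, stdAlt]
  split_ifs <;> omega

/-- The alternating `m × m` matrix with `2 × 2` diagonal blocks. -/
def stdAltMat (m : ℕ) (S : Type*) [CommRing S] : Matrix (Fin m) (Fin m) S :=
  Matrix.of fun a b => (stdAlt a b : S)

variable {S : Type*} [CommRing S]

theorem isAltMat_stdAltMat (m : ℕ) : IsAltMat (stdAltMat m S) := by
  refine ⟨fun i => ?_, fun i j => ?_⟩
  · simp [stdAltMat, stdAlt_self]
  · simp [stdAltMat, stdAlt_swap (i : ℕ) j]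

theorem stdAltMat_map {S' : Type*} [CommRing S'] (m : ℕ) (φ : S →+* S') :
    (stdAltMat m S).map φ = stdAltMat m S' := by
  ext i j
  simp [stdAltMat]

theorem pfl_submatrix {κ κ' : Type*} (y : Matrix κ κ S) (f : κ' → κ) (l : List κ') :
    pfl (y.submatrix f f) l = pfl y (l.map f) := by
  induction l using list_erase_induction with
  | nil => simp [pfl_nil]
  | cons a l ih =>
    rw [List.map_cons, pfl_cons, pfl_cons]
    refine Fintype.sum_equiv (finCongr (by simp)) _ _ fun k => ?_
    simp [ih, List.eraseIdx_map]

theorem pfl_stdAlt_range' (s l : ℕ) (hs : Even s) :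
    pfl (Matrix.of fun a b => (stdAlt a b : S)) (List.range' s (2 * l)) = 1 := by
  induction l generalizing s with
  | zero => simp [pfl_nil]
  | succ l ih =>
    rw [mul_add, mul_one, List.range'_succ, List.range'_succ, pfl_cons,
      Finset.sum_eq_single ⟨0, by simp⟩]
    · have h1 : stdAlt s (s + 1) = 1 := by simp [stdAlt, hs]
      have h2 := ih (s + 1 + 1) (hs.add even_two)
      simp [h1, h2]
    · rintro ⟨k, hk⟩ - hne
      have hk0 : k ≠ 0 := fun h => hne (by simp [h])
      have : stdAlt s ((s + 1) :: List.range' (s + 1 + 1) (2 * l))[k] = 0 := by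
        obtain ⟨k, rfl⟩ := Nat.exists_eq_succ_of_ne_zero hk0
        simp only [Nat.succ_eq_add_one, List.getElem_cons_succ, List.getElem_range']
        rw [stdAlt, if_neg (by omega), if_neg (by omega)]
      simp [this]
    · simp

theorem pfl_stdAltMat {m n : ℕ} (hn : Even n) (t : Fin n → Fin m) (ht : ∀ k, (t k : ℕ) = k) :
    pfl (stdAltMat m S) (List.ofFn t) = 1 := by
  obtain ⟨l, rfl⟩ := hn
  have h := pfl_submatrix (Matrix.of fun a b => (stdAlt a b : S)) (Fin.val : Fin m → ℕ)
    (List.ofFn t)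
  have h2 : (List.ofFn t).map Fin.val = List.range' 0 (2 * l) := by
    rw [List.map_ofFn, ← List.range_eq_range', two_mul]
    refine List.ext_getElem (by simp) fun k h1 h2 => ?_
    simp [ht]
  rw [h2, pfl_stdAlt_range' 0 l Even.zero] at h
  exact h

theorem IsAltMat.mul_mul_transpose {κ : Type*} {m : ℕ} {E : Matrix (Fin m) (Fin m) S}
    (hE : IsAltMat E) (P : Matrix κ (Fin m) S) : IsAltMat (P * E * Pᵀ) := by
  have hB := isAlt_toBilin' hE
  have h : ∀ i j, (P * E * Pᵀ) i j = Matrix.toBilin' E (P i) (P j) := by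
    intro i j
    rw [Matrix.toBilin'_apply', Matrix.mul_assoc, Matrix.mul_apply']
    rfl
  exact ⟨fun i => by rw [h, hB], fun i j => by rw [h, h]; exact (LinearMap.IsAlt.neg hB _ _).symm⟩

theorem pfl_mul_mul_transpose {κ : Type*} {m n : ℕ} {E : Matrix (Fin m) (Fin m) S}
    (hE : IsAltMat E) (P : Matrix κ (Fin m) S) (g : Fin n → κ) :
    pfl (P * E * Pᵀ) (List.ofFn g) =
      ∑ t : Fin n → Fin m, (∏ k, P (g k) (t k)) * pfl E (List.ofFn t) := by
  have hB := isAlt_toBilin' hE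
  have h : P * E * Pᵀ = Matrix.of fun i j => Matrix.toBilin' E (P i) (P j) := by
    ext i j
    rw [Matrix.of_apply, Matrix.toBilin'_apply', Matrix.mul_assoc, Matrix.mul_apply']
    rfl
  have h1 : (fun k => P (g k)) = fun k => ∑ a, P (g k) a • (Pi.single a 1 : Fin m → S) := by
    ext k a
    simp [Pi.single_apply]
  rw [h, ← pfForm_wedge hB (fun i => P i), List.map_ofFn, ← ιMulti_eq_wedge]
  change pfForm _ hB (ExteriorAlgebra.ιMulti S n fun k => P (g k)) = _
  rw [h1, ← AlternatingMap.coe_multilinearMap, MultilinearMap.map_sum, map_sum]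
  refine Finset.sum_congr rfl fun t _ => ?_
  rw [MultilinearMap.map_smul_univ, map_smul, smul_eq_mul, AlternatingMap.coe_multilinearMap,
    ιMulti_eq_wedge, ← pfForm_toBilin' hE, List.map_ofFn]
  rfl

end StandardForm

section LeadingTerms

variable {r : ℕ} (F : Type*) [Field F]

/-- The variables of the triangular generic matrix, ordered lexicographically. -/
abbrev Slot (r : ℕ) := Fin (2 * r) ×ₗ Fin (2 * r)

/-- The variable in row `i` and column `k`. -/
def slot (i : Fin r × Bool) (k : Fin (2 * r)) : Slot r := toLex (⟨idxPos i, idxPos_lt i⟩, k)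

theorem slot_inj {i j : Fin r × Bool} {k l : Fin (2 * r)} :
    slot i k = slot j l ↔ i = j ∧ k = l := by
  simp [slot, Prod.ext_iff, Fin.ext_iff, idxPos_injective.eq_iff]

theorem slot_lt_slot {i j : Fin r × Bool} {k l : Fin (2 * r)} :
    slot i k < slot j l ↔ idxPos i < idxPos j ∨ i = j ∧ k < l := by
  simp [slot, Prod.Lex.toLex_lt_toLex, Fin.ext_iff, idxPos_injective.eq_iff]

theorem le_two_mul : r ≤ 2 * r := by omega

theorem card_row_le (x : Finset (Fin r × Bool)) : x.card ≤ 2 * r := by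
  have := x.card_le_univ
  rw [Fintype.card_prod, Fintype.card_fin, Fintype.card_bool] at this
  omega

theorem IsSymplecticRow.card_le {x : Finset (Fin r × Bool)} (hx : IsSymplecticRow x) :
    x.card ≤ r := by
  have := hx r
  rwa [Finset.filter_true_of_mem fun i _ => i.1.isLt] at this

/-- The generic matrix whose row `(p, b)` is supported in the columns `0, …, p`. -/
def triGeneric (r : ℕ) : Matrix (Fin r × Bool) (Fin r) (MvPolynomial (Slot r) F) :=
  Matrix.of fun i t => if t ≤ i.1 then MvPolynomial.X (slot i (t.castLE le_two_mul)) else 0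

/-- The exponent of the leading monomial of the Pfaffian of a symplectic row. -/
def rowDeg (x : Finset (Fin r × Bool)) : Slot r →₀ ℕ :=
  ∑ k : Fin x.card, Finsupp.single (slot (enum x k) (k.castLE (card_row_le x))) 1

/-- The exponent of the monomial in which the `k`-th element of `x` selects the column `t k`. -/
def choiceDeg (x : Finset (Fin r × Bool)) (t : Fin x.card → Fin (2 * r)) : Slot r →₀ ℕ :=
  ∑ k : Fin x.card, Finsupp.single (slot (enum x k) (t k)) 1

theorem choiceDeg_slot (x : Finset (Fin r × Bool)) (t : Fin x.card → Fin (2 * r))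
    (k : Fin x.card) (c : Fin (2 * r)) :
    choiceDeg x t (slot (enum x k) c) = if t k = c then 1 else 0 := by
  rw [choiceDeg, Finsupp.finsetSum_apply, Finset.sum_eq_single k]
  · simp [Finsupp.single_apply, slot_inj]
  · intro l _ hl
    rw [Finsupp.single_apply, if_neg]
    exact fun h => hl (enum_injective x (slot_inj.1 h).1)
  · simp

theorem choiceDeg_lt_rowDeg {x : Finset (Fin r × Bool)} {t : Fin x.card → Fin (2 * r)}
    (ht : Function.Injective t) (hne : ∃ k, (t k : ℕ) ≠ k) :
    toLex (choiceDeg x t) < toLex (rowDeg x) := by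
  classical
  obtain ⟨k, hk, hmin⟩ : ∃ k, (t k : ℕ) ≠ k ∧ ∀ l < k, (t l : ℕ) = l := by
    obtain ⟨k, hk⟩ := (Set.toFinite {k | (t k : ℕ) ≠ k}).exists_minimal hne
    exact ⟨k, hk.1, fun l hl => by_contra fun h => absurd (hk.2 h hl.le) (not_le.2 hl)⟩
  have hlt : (k : ℕ) < t k := by
    by_contra h
    have h1 : (t k : ℕ) < k := by omega
    have h2 := hmin ⟨t k, by omega⟩ h1
    exact hk (congrArg Fin.val (ht (Fin.ext h2)))
  have hrow : rowDeg x = choiceDeg x fun k => k.castLE (card_row_le x) := rfl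
  rw [hrow]
  refine ⟨slot (enum x k) (k.castLE (card_row_le x)), fun v hv => ?_, ?_⟩
  · obtain ⟨i, c, rfl⟩ : ∃ (i : Fin (2 * r)) (c : Fin (2 * r)), v = toLex (i, c) := ⟨_, _, rfl⟩
    by_cases hi : ∃ l, i = ⟨idxPos (enum x l), idxPos_lt _⟩
    · obtain ⟨l, rfl⟩ := hi
      change choiceDeg x t (slot (enum x l) c) = choiceDeg x _ (slot (enum x l) c)
      rw [choiceDeg_slot, choiceDeg_slot]
      rcases slot_lt_slot.1 hv with h | ⟨h, hc⟩
      · have h1 := hmin l ((enum_strictMono x).lt_iff_lt.1 h)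
        simp [Fin.ext_iff, h1]
      · obtain rfl := enum_injective x h
        rw [Fin.lt_def, Fin.val_castLE] at hc
        rw [if_neg (fun h => by omega), if_neg (fun h => by rw [← h] at hc; simp at hc)]
    · have h0 : ∀ t : Fin x.card → Fin (2 * r), choiceDeg x t (toLex (i, c)) = 0 := by
        intro t
        rw [choiceDeg, Finsupp.finsetSum_apply]
        refine Finset.sum_eq_zero fun l _ => ?_
        rw [Finsupp.single_apply, if_neg]
        intro h
        exact hi ⟨l, (Prod.ext_iff.1 (toLex.injective h)).1.symm⟩
      exact (h0 _).trans (h0 _).symm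
  · change choiceDeg x t _ < choiceDeg x _ _
    rw [choiceDeg_slot, choiceDeg_slot, if_neg (fun h => hk (by rw [h]; rfl)), if_pos rfl]
    exact one_pos

variable {F}

/-- The base change to the generic triangular matrix of the standard alternating form. -/
def triPoint (F : Type*) [Field F] (r : ℕ) :
    Matrix (Fin r × Bool) (Fin r × Bool) (MvPolynomial (Slot r) F) :=
  triGeneric F r * stdAltMat r (MvPolynomial (Slot r) F) * (triGeneric F r)ᵀ

theorem isAltMat_triPoint : IsAltMat (triPoint F r) :=
  (isAltMat_stdAltMat r).mul_mul_transpose _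

theorem pfl_triPoint (x : Finset (Fin r × Bool)) :
    pfl (triPoint F r) (List.ofFn (enum x)) =
      ∑ t : Fin x.card → Fin r, MvPolynomial.monomial
        (choiceDeg x fun k => (t k).castLE le_two_mul)
        (if ∀ k, t k ≤ (enum x k).1 then pfl (stdAltMat r F) (List.ofFn t) else 0) := by
  rw [triPoint, pfl_mul_mul_transpose (isAltMat_stdAltMat r)]
  refine Finset.sum_congr rfl fun t _ => ?_
  split_ifs with h
  · rw [choiceDeg, MvPolynomial.monomial_sum_index, mul_comm, ← stdAltMat_map r MvPolynomial.C,
      ← map_pfl]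
    refine congrArg _ (Finset.prod_congr rfl fun k _ => ?_)
    rw [triGeneric, Matrix.of_apply, if_pos (h k)]
    rfl
  · push Not at h
    obtain ⟨k, hk⟩ := h
    rw [Finset.prod_eq_zero (Finset.mem_univ k), zero_mul, map_zero]
    rw [triGeneric, Matrix.of_apply, if_neg (not_le.2 hk)]

theorem degree_pfs_triPoint {x : Finset (Fin r × Bool)} (hx : IsSymplecticRow x)
    (he : Even x.card) :
    pfs (triPoint F r) x ≠ 0 ∧ MonomialOrder.lex.degree (pfs (triPoint F r) x) = rowDeg x := by
  set f := pfl (triPoint F r) (List.ofFn (enum x)) with hf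
  have hlt : ∀ t : Fin x.card → Fin r, (if ∀ k, t k ≤ (enum x k).1 then
      pfl (stdAltMat r F) (List.ofFn t) else 0) ≠ 0 → (∃ k, (t k : ℕ) ≠ k) →
      toLex (choiceDeg x fun k => (t k).castLE le_two_mul) < toLex (rowDeg x) := by
    intro t ht hne
    refine choiceDeg_lt_rowDeg (fun k l hkl => ?_) hne
    have hnd : (List.ofFn t).Nodup := by
      by_contra h
      exact ht (by rw [pfl_eq_zero_of_not_nodup (isAltMat_stdAltMat r) h, ite_self])
    exact List.nodup_ofFn.1 hnd (Fin.castLE_injective _ hkl)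
  have hcoeff : f.coeff (rowDeg x) = 1 := by
    rw [hf, pfl_triPoint, MvPolynomial.coeff_sum,
      Finset.sum_eq_single fun k => k.castLE hx.card_le]
    · rw [MvPolynomial.coeff_monomial]
      refine (if_pos rfl).trans ((if_pos fun k => ?_).trans (pfl_stdAltMat he _ fun k => rfl))
      exact hx.le_enum k
    · intro t _ ht
      rw [MvPolynomial.coeff_monomial]
      by_contra h
      rw [ite_eq_right_iff, not_forall] at h
      obtain ⟨h1, h2⟩ := h
      refine (hlt t h2 ?_).ne (by rw [h1])
      by_contra hall
      push Not at hall
      exact ht (funext fun k => Fin.ext (hall k))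
    · simp
  have hdeg : MonomialOrder.lex.degree f = rowDeg x := by
    refine MonomialOrder.lex.toSyn.injective (le_antisymm ?_ ?_)
    · rw [MonomialOrder.degree_le_iff]
      intro d hd
      rw [MvPolynomial.mem_support_iff, hf, pfl_triPoint, MvPolynomial.coeff_sum] at hd
      obtain ⟨t, -, ht⟩ := Finset.exists_ne_zero_of_sum_ne_zero hd
      rw [MvPolynomial.coeff_monomial] at ht
      rw [ne_eq, ite_eq_right_iff, not_forall] at ht
      obtain ⟨rfl, h2⟩ := ht
      by_cases hne : ∃ k, (t k : ℕ) ≠ k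
      · exact (hlt t h2 hne).le
      · push Not at hne
        refine le_of_eq (congrArg _ (Finset.sum_congr rfl fun k _ => ?_))
        congr 2
        exact Fin.ext (hne k)
    · exact MonomialOrder.le_degree (by simp [MvPolynomial.mem_support_iff, hcoeff])
  have hne : f ≠ 0 := by
    rintro h
    simp [h] at hcoeff
  have hset : (List.ofFn (enum x)).toFinset = x := by
    conv_rhs => rw [← image_enum x]
    ext i
    simp [List.mem_ofFn]
  rcases pfl_eq_pfs (isAltMat_triPoint (F := F)) (List.nodup_ofFn.2 (enum_injective x)) with h | h
  · rw [hset] at h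
    rw [← h]
    exact ⟨hne, hdeg⟩
  · rw [hset, ← hf] at h
    rw [← neg_eq_iff_eq_neg.2 h, MonomialOrder.degree_neg]
    exact ⟨neg_ne_zero.2 hne, hdeg⟩

theorem degree_tabProd_triPoint {T : Multiset (Finset (Fin r × Bool))} (hT : IsStdTab T) :
    tabProd (triPoint F r) T ≠ 0 ∧
      MonomialOrder.lex.degree (tabProd (triPoint F r) T) = (T.map rowDeg).sum := by
  induction T using Multiset.induction with
  | empty => simp [tabProd]
  | cons x T ih =>
    have h1 := degree_pfs_triPoint (F := F) (hT.symplectic x (Multiset.mem_cons_self x T))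
      (hT.even x (Multiset.mem_cons_self x T))
    have h2 := ih hT.of_cons
    rw [tabProd_cons, Multiset.map_cons, Multiset.sum_cons, MonomialOrder.degree_mul h1.1 h2.1,
      h1.2, h2.2]
    exact ⟨mul_ne_zero h1.1 h2.1, rfl⟩

/-- The number of factors of a monomial in column `k` and a row of position at most `a`. -/
def colCount (a k : ℕ) : (Slot r →₀ ℕ) →+ ℕ where
  toFun d := ∑ v : Slot r, if ((ofLex v).1 : ℕ) ≤ a ∧ ((ofLex v).2 : ℕ) = k then d v else 0
  map_zero' := by simp
  map_add' d e := by
    rw [← Finset.sum_add_distrib]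
    refine Finset.sum_congr rfl fun v _ => ?_
    split_ifs <;> simp

theorem colCount_single (a k : ℕ) (i : Fin r × Bool) (c : Fin (2 * r)) :
    colCount a k (Finsupp.single (slot i c) 1) = if idxPos i ≤ a ∧ (c : ℕ) = k then 1 else 0 := by
  change (∑ v : Slot r, _) = _
  rw [Finset.sum_eq_single (slot i c)]
  · rw [Finsupp.single_eq_same]
    rfl
  · intro v _ hv
    rw [Finsupp.single_eq_of_ne hv, ite_self]
  · simp

theorem colCount_rowDeg (a k : ℕ) (x : Finset (Fin r × Bool)) :
    colCount a k (rowDeg x) = if k < cnt idxPos x a then 1 else 0 := by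
  rw [rowDeg, map_sum]
  simp only [colCount_single, Fin.val_castLE, idxPos_enum_le_iff]
  have hc : cnt idxPos x a ≤ x.card := Finset.card_filter_le _ _
  split_ifs with h
  · rw [Finset.sum_eq_single ⟨k, h.trans_le hc⟩]
    · rw [if_pos ⟨h, rfl⟩]
    · intro l _ hl
      rw [if_neg]
      rintro ⟨-, rfl⟩
      exact hl rfl
    · simp
  · refine Finset.sum_eq_zero fun l _ => if_neg ?_
    rintro ⟨h1, rfl⟩
    exact h h1

theorem IsStdTab.ext_rowDeg {T U : Multiset (Finset (Fin r × Bool))} (hT : IsStdTab T)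
    (hU : IsStdTab U) (h : (T.map rowDeg).sum = (U.map rowDeg).sum) : T = U := by
  refine hT.ext hU fun a k => ?_
  have hcount : ∀ T : Multiset (Finset (Fin r × Bool)),
      colCount a k (T.map rowDeg).sum = T.countP (fun x => k < cnt idxPos x a) := by
    intro T
    induction T using Multiset.induction with
    | empty => simp
    | cons x T ih =>
      rw [Multiset.map_cons, Multiset.sum_cons, map_add, ih, colCount_rowDeg, Multiset.countP_cons,
        add_comm]
  rw [← hcount, ← hcount, h]

theorem eq_zero_of_sum_tabProd_triPoint {s : Finset (Multiset (Finset (Fin r × Bool)))}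
    (hs : ∀ T ∈ s, IsStdTab T) (c : Multiset (Finset (Fin r × Bool)) → F)
    (h : ∑ T ∈ s, MvPolynomial.C (c T) * tabProd (triPoint F r) T = 0) : ∀ T ∈ s, c T = 0 := by
  classical
  by_contra hne
  push Not at hne
  obtain ⟨T₀, hT₀, hc₀⟩ := hne
  obtain ⟨T, hT, hmax⟩ := (s.filter fun T => c T ≠ 0).exists_max_image
    (fun T => MonomialOrder.lex.toSyn (T.map rowDeg).sum) ⟨T₀, Finset.mem_filter.2 ⟨hT₀, hc₀⟩⟩
  rw [Finset.mem_filter] at hT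
  have hd := degree_tabProd_triPoint (F := F) (hs T hT.1)
  have hcoeff := congrArg (MvPolynomial.coeff (T.map rowDeg).sum) h
  rw [MvPolynomial.coeff_sum, Finset.sum_eq_single T] at hcoeff
  · rw [MvPolynomial.coeff_C_mul, MvPolynomial.coeff_zero, mul_eq_zero, ← hd.2,
      MonomialOrder.coeff_degree_eq_zero_iff] at hcoeff
    exact hcoeff.elim hT.2 hd.1
  · intro U hU hUT
    rw [MvPolynomial.coeff_C_mul]
    by_cases hcU : c U = 0
    · rw [hcU, zero_mul]
    rw [MonomialOrder.coeff_eq_zero_of_lt, mul_zero]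
    rw [(degree_tabProd_triPoint (hs U hU)).2]
    refine lt_of_le_of_ne (hmax U (Finset.mem_filter.2 ⟨hU, hcU⟩)) fun he => hUT ?_
    exact (hs U hU).ext_rowDeg (hs T hT.1) (MonomialOrder.lex.toSyn.injective he)
  · exact fun hn => absurd hT.1 hn

end LeadingTerms

section Degeneration

open Polynomial

variable {r : ℕ} (F : Type*) [Field F]

theorem exists_algHom_genericPoint {S : Type*} [CommRing S] [IsDomain S] [Algebra F S]
    {M : Matrix (Fin r × Bool) (Fin r × Bool) S} (hM : IsAltMat M)
    (hiso : ∀ i j, ∑ p : Fin r,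
      (M (p, true) i * M (p, false) j - M (p, false) i * M (p, true) j) = 0) :
    ∃ ψ : FV r F →ₐ[F] S, ((genericPoint F r).submatrix idx idx).map ψ = M := by
  set e := Equiv.ofBijective _ (idx_bijective (r := r))
  have he : ∀ i, e.symm (idx i) = i := e.symm_apply_apply
  set Y : Matrix (Fin (2 * r)) (Fin (2 * r)) S := M.submatrix e.symm e.symm with hYdef
  have hY : MemV r Y := by
    refine memV_of_isotropic ⟨fun i => hM.1 _, fun i j => hM.2 _ _⟩ fun i j => ?_
    have h1 : ∀ p : Fin r, e.symm (emb r p) = (p, true) := fun p => he (p, true)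
    have h2 : ∀ p : Fin r, e.symm (embBar r p) = (p, false) := fun p => he (p, false)
    simp only [hYdef, Matrix.submatrix_apply, h1, h2]
    exact hiso _ _
  refine ⟨Ideal.Quotient.liftₐ _ _ (VIdeal_le_ker F hY), ?_⟩
  ext i j
  change (MvPolynomial.aeval fun q : Fin (2 * r) × Fin (2 * r) => Y q.1 q.2)
    (MvPolynomial.X (idx i, idx j) : PolyRing r F) = _
  rw [MvPolynomial.aeval_X, hYdef, Matrix.submatrix_apply, he, he]

/-- The matrix with the rows of `A` at the indices `(p, true)` and of `B` at `(p, false)`. -/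
def interleave {S : Type*} (A B : Matrix (Fin r) (Fin r) S) :
    Matrix (Fin r × Bool) (Fin r) S :=
  Matrix.of fun i t => if i.2 then A i.1 t else B i.1 t

theorem sum_interleave_eq_zero {S : Type*} [CommRing S] {A B : Matrix (Fin r) (Fin r) S}
    (h : Aᵀ * B = Bᵀ * A) (E : Matrix (Fin r) (Fin r) S) (i j : Fin r × Bool) :
    let M := interleave A B * E * (interleave A B)ᵀ
    ∑ p : Fin r, (M (p, true) i * M (p, false) j - M (p, false) i * M (p, true) j) = 0 := by
  intro M
  set W := E * (interleave A B)ᵀ with hW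
  have h1 : ∀ p i, M (p, true) i = (A * W) p i := fun p i => by
    simp only [M, Matrix.mul_assoc, ← hW]
    rfl
  have h2 : ∀ p i, M (p, false) i = (B * W) p i := fun p i => by
    simp only [M, Matrix.mul_assoc, ← hW]
    rfl
  simp only [h1, h2, Finset.sum_sub_distrib]
  have h3 : (A * W)ᵀ * (B * W) = (B * W)ᵀ * (A * W) := by
    rw [Matrix.transpose_mul A, Matrix.transpose_mul B, Matrix.mul_assoc, ← Matrix.mul_assoc Aᵀ, h,
      Matrix.mul_assoc Wᵀ, ← Matrix.mul_assoc Bᵀ]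
  exact sub_eq_zero.2 (congrFun (congrFun h3 i) j)

variable {F} {K : Type*} [Field K]

/-- The polynomial family of matrices which is the lower triangular part of `l` at `0`. -/
def symmFamily (l : Matrix (Fin r) (Fin r) K) : Matrix (Fin r) (Fin r) K[X] :=
  Matrix.of fun p t => if t ≤ p then C (l p t) else X ^ (2 * (t - p : ℕ)) * C (l t p)

theorem X_pow_mul_symmFamily (l : Matrix (Fin r) (Fin r) K) (p t : Fin r) :
    X ^ (2 * p : ℕ) * symmFamily l p t = X ^ (2 * t : ℕ) * symmFamily l t p := by
  rw [symmFamily, Matrix.of_apply, Matrix.of_apply]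
  rcases lt_trichotomy p t with h | rfl | h
  · rw [if_neg (not_le.2 h), if_pos h.le, ← mul_assoc, ← pow_add]
    congr 2
    rw [Fin.lt_def] at h
    omega
  · rfl
  · rw [if_neg (not_le.2 h), if_pos h.le, ← mul_assoc, ← pow_add]
    congr 2
    rw [Fin.lt_def] at h
    omega

/-- The family of alternating matrices obtained from `E` by the rows of `symmFamily l` and `1`. -/
def innerFamily (l E : Matrix (Fin r) (Fin r) K) : Matrix (Fin r × Bool) (Fin r × Bool) K[X] :=
  interleave (symmFamily l) 1 * E.map C * (interleave (symmFamily l) 1)ᵀ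

/-- The family `innerFamily`, rescaled so as to be isotropic. -/
def isoFamily (l E : Matrix (Fin r) (Fin r) K) : Matrix (Fin r × Bool) (Fin r × Bool) K[X] :=
  Matrix.of fun i j => X ^ (i.1 : ℕ) * X ^ (j.1 : ℕ) * innerFamily l E i j

theorem isoFamily_eq (l E : Matrix (Fin r) (Fin r) K) :
    isoFamily l E = interleave (Matrix.diagonal (fun p : Fin r => X ^ (p : ℕ)) * symmFamily l)
        (Matrix.diagonal fun p : Fin r => X ^ (p : ℕ)) * E.map C *
      (interleave (Matrix.diagonal (fun p : Fin r => X ^ (p : ℕ)) * symmFamily l)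
        (Matrix.diagonal fun p : Fin r => X ^ (p : ℕ)))ᵀ := by
  have h : interleave (Matrix.diagonal (fun p : Fin r => (X : K[X]) ^ (p : ℕ)) * symmFamily l)
      (Matrix.diagonal fun p : Fin r => X ^ (p : ℕ)) =
      (Matrix.diagonal (fun i => X ^ (i.1 : ℕ)) : Matrix (Fin r × Bool) (Fin r × Bool) K[X]) *
        (interleave (symmFamily l) 1 : Matrix (Fin r × Bool) (Fin r) K[X]) := by
    refine Matrix.ext fun ⟨p, b⟩ t => ?_
    rw [Matrix.diagonal_mul]
    cases b <;> simp [interleave, Matrix.diagonal_apply, Matrix.one_apply]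
  refine Matrix.ext fun i j => ?_
  rw [h, Matrix.transpose_mul, Matrix.diagonal_transpose, ← Matrix.mul_assoc, Matrix.mul_diagonal,
    Matrix.mul_assoc (Matrix.diagonal _), Matrix.mul_assoc (Matrix.diagonal _),
    Matrix.diagonal_mul, isoFamily, Matrix.of_apply, innerFamily]
  ring

theorem isAltMat_map {S S' : Type*} [CommRing S] [CommRing S'] {κ : Type*} {E : Matrix κ κ S}
    (hE : IsAltMat E) (φ : S →+* S') : IsAltMat (E.map φ) :=
  ⟨fun i => by rw [Matrix.map_apply, hE.1, map_zero],
    fun i j => by rw [Matrix.map_apply, Matrix.map_apply, hE.2, map_neg]⟩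

theorem exists_algHom_isoFamily [Algebra F K] (l : Matrix (Fin r) (Fin r) K)
    {E : Matrix (Fin r) (Fin r) K} (hE : IsAltMat E) :
    ∃ ψ : FV r F →ₐ[F] K[X], ((genericPoint F r).submatrix idx idx).map ψ = isoFamily l E := by
  refine exists_algHom_genericPoint F ?_ ?_
  · rw [isoFamily_eq]
    exact (isAltMat_map hE C).mul_mul_transpose _
  · rw [isoFamily_eq]
    refine sum_interleave_eq_zero ?_ _
    refine Matrix.ext fun s u => ?_
    rw [Matrix.transpose_mul, Matrix.diagonal_transpose, Matrix.mul_assoc,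
      Matrix.diagonal_mul_diagonal, Matrix.mul_diagonal, ← Matrix.mul_assoc,
      Matrix.diagonal_mul_diagonal, Matrix.diagonal_mul, Matrix.transpose_apply, mul_comm,
      ← pow_add, ← pow_add, ← two_mul, ← two_mul, X_pow_mul_symmFamily]

theorem symmFamily_map_eval_zero {l : Matrix (Fin r) (Fin r) K} (hl : ∀ p t, p < t → l p t = 0) :
    (symmFamily l).map (evalRingHom 0) = l := by
  ext p t
  rw [Matrix.map_apply, symmFamily, Matrix.of_apply, coe_evalRingHom]
  split_ifs with h
  · simp
  · rw [not_le] at h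
    have h' : 2 * (t - p : ℕ) ≠ 0 := by
      rw [Fin.lt_def] at h
      omega
    simp [hl p t h, h']

theorem interleave_map {S S' : Type*} (A B : Matrix (Fin r) (Fin r) S) (f : S → S') :
    (interleave A B).map f = interleave (A.map f) (B.map f) := by
  ext ⟨p, b⟩ t
  cases b <;> rfl

theorem interleave_mul {S : Type*} [CommRing S] (A B T : Matrix (Fin r) (Fin r) S) :
    interleave A B * T = interleave (A * T) (B * T) := by
  ext ⟨p, b⟩ t
  cases b <;> rfl

theorem innerFamily_map_eval_zero {l : Matrix (Fin r) (Fin r) K} (hl : ∀ p t, p < t → l p t = 0)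
    (T E : Matrix (Fin r) (Fin r) K) :
    (innerFamily l (T * E * Tᵀ)).map (evalRingHom 0) =
      interleave (l * T) T * E * (interleave (l * T) T)ᵀ := by
  have h : (interleave (symmFamily l) 1).map (evalRingHom 0) = interleave l 1 := by
    rw [interleave_map, symmFamily_map_eval_zero hl]
    simp
  have h2 : ∀ M : Matrix (Fin r) (Fin r) K, (M.map C).map (evalRingHom 0) = M := fun M => by
    ext i j
    simp
  have h3 : interleave (l * T) T = interleave l 1 * T := by
    rw [interleave_mul, Matrix.one_mul]
  rw [innerFamily, Matrix.map_mul, Matrix.map_mul, Matrix.transpose_map, h, h2, h3,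
    Matrix.transpose_mul]
  simp only [Matrix.mul_assoc]

theorem tabProd_isoFamily (l E : Matrix (Fin r) (Fin r) K)
    (T : Multiset (Finset (Fin r × Bool))) :
    tabProd (isoFamily l E) T =
      X ^ (T.map fun x => ∑ i ∈ x, (i.1 : ℕ)).sum * tabProd (innerFamily l E) T := by
  have h : ∀ x, pfs (isoFamily l E) x = X ^ (∑ i ∈ x, (i.1 : ℕ)) * pfs (innerFamily l E) x := by
    intro x
    rw [pfs, pfs, isoFamily, pfl_diag_mul, Finset.prod_map_toList, Finset.prod_pow_eq_pow_sum]
  induction T using Multiset.induction with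
  | empty => simp [tabProd]
  | cons x T ih =>
    rw [tabProd_cons, tabProd_cons, ih, h, Multiset.map_cons, Multiset.sum_cons, pow_add]
    ring

theorem map_tabProd {S S' H : Type*} [CommRing S] [CommRing S'] [FunLike H S S']
    [RingHomClass H S S'] (φ : H) (y : Matrix (Fin r × Bool) (Fin r × Bool) S)
    (T : Multiset (Finset (Fin r × Bool))) : φ (tabProd y T) = tabProd (y.map φ) T := by
  rw [tabProd, map_multiset_prod, Multiset.map_map, tabProd]
  exact congrArg _ (Multiset.map_congr rfl fun x _ => map_pfs (φ : S →+* S') y x)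

theorem eq_zero_of_sum_X_pow_mul {α : Type*} {s : Finset α} (c : α → K) (n : α → ℕ)
    (f : α → K[X]) (hf : ∀ s' ⊆ s, ∑ a ∈ s', c a * (f a).coeff 0 = 0 → ∀ a ∈ s', c a = 0)
    (h : ∑ a ∈ s, C (c a) * (X ^ n a * f a) = 0) : ∀ a ∈ s, c a = 0 := by
  classical
  by_contra hne
  push Not at hne
  obtain ⟨a₀, ha₀, hc₀⟩ := hne
  obtain ⟨a, ha, hmin⟩ := (s.filter fun a => c a ≠ 0).exists_min_image n
    ⟨a₀, Finset.mem_filter.2 ⟨ha₀, hc₀⟩⟩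
  rw [Finset.mem_filter] at ha
  refine ha.2 (hf (s.filter fun b => c b ≠ 0 ∧ n b = n a) (Finset.filter_subset _ _) ?_ a
    (Finset.mem_filter.2 ⟨ha.1, ha.2, rfl⟩))
  have hcoeff := congrArg (coeff · (n a)) h
  simp only [finsetSum_coeff, coeff_C_mul, coeff_X_pow_mul', coeff_zero] at hcoeff
  rw [Finset.sum_filter]
  refine (Finset.sum_congr rfl fun b hb => ?_).trans hcoeff
  by_cases hc : c b = 0
  · simp [hc]
  have hle := hmin b (Finset.mem_filter.2 ⟨hb, hc⟩)
  by_cases he : n b = n a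
  · simp [hc, he]
  · rw [if_neg (fun h => he h.2), if_neg (by omega), mul_zero]

end Degeneration

section Target

open Polynomial

variable (F : Type*) [Field F] (r : ℕ)

/-- The field of fractions of the ring of the generic triangular matrix. -/
abbrev TriField := FractionRing (MvPolynomial (Slot r) F)

/-- The rows of `triGeneric` with the given parity, over the field of fractions. -/
def triRows (b : Bool) : Matrix (Fin r) (Fin r) (TriField F r) :=
  Matrix.of fun p t => algebraMap _ _ (triGeneric F r (p, b) t)

variable {F r}

theorem triRows_eq_zero (b : Bool) {p t : Fin r} (h : p < t) : triRows F r b p t = 0 := by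
  rw [triRows, Matrix.of_apply, triGeneric, Matrix.of_apply, if_neg (not_le.2 h), map_zero]

theorem isUnit_det_triRows (b : Bool) : IsUnit (triRows F r b).det := by
  rw [isUnit_iff_ne_zero, Matrix.det_of_isLowerTriangular _ fun i j h => triRows_eq_zero b h,
    Finset.prod_ne_zero_iff]
  intro p _
  rw [triRows, Matrix.of_apply, triGeneric, Matrix.of_apply, if_pos le_rfl, Ne,
    FaithfulSMul.algebraMap_eq_zero_iff]
  exact MvPolynomial.X_ne_zero _

theorem interleave_triRows :
    interleave (triRows F r true) (triRows F r false) = (triGeneric F r).map (algebraMap _ _) := by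
  ext ⟨p, b⟩ t
  cases b <;> rfl

variable (F r) in
/-- The quotient of the two triangular blocks of `triGeneric`. -/
def triQuot : Matrix (Fin r) (Fin r) (TriField F r) := triRows F r true * (triRows F r false)⁻¹

theorem triQuot_eq_zero {p t : Fin r} (h : p < t) : triQuot F r p t = 0 := by
  have hinv := Matrix.invertibleOfIsUnitDet _ (isUnit_det_triRows (F := F) (r := r) false)
  have h1 : (triRows F r true).BlockTriangular OrderDual.toDual := fun i j h =>
    triRows_eq_zero true h
  have h2 : (triRows F r false).BlockTriangular OrderDual.toDual := fun i j h =>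
    triRows_eq_zero false h
  exact (h1.mul (Matrix.blockTriangular_inv_of_blockTriangular h2)) h

variable (F r) in
/-- The block of `triPoint` indexed by the barred indices. -/
def barBlock : Matrix (Fin r) (Fin r) (TriField F r) :=
  triRows F r false * stdAltMat r (TriField F r) * (triRows F r false)ᵀ

theorem innerFamily_triQuot_map_eval_zero :
    (innerFamily (triQuot F r) (barBlock F r)).map (evalRingHom 0) =
      (triPoint F r).map (algebraMap _ (TriField F r)) := by
  rw [barBlock, innerFamily_map_eval_zero fun p t h => triQuot_eq_zero h, triQuot,
    Matrix.nonsing_inv_mul_cancel_right _ _ (isUnit_det_triRows false), interleave_triRows, triPoint,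
    Matrix.map_mul, Matrix.map_mul, stdAltMat_map, Matrix.transpose_map]

theorem eq_zero_of_sum_tabProd_isoFamily {s : Finset (Multiset (Finset (Fin r × Bool)))}
    (hs : ∀ T ∈ s, IsStdTab T) (c : Multiset (Finset (Fin r × Bool)) → F)
    (h : ∑ T ∈ s, c T • tabProd (isoFamily (triQuot F r) (barBlock F r)) T = 0) :
    ∀ T ∈ s, c T = 0 := by
  have key := eq_zero_of_sum_X_pow_mul (s := s) (fun T => algebraMap F (TriField F r) (c T))
    (fun T => (T.map fun x => ∑ i ∈ x, (i.1 : ℕ)).sum)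
    (fun T => tabProd (innerFamily (triQuot F r) (barBlock F r)) T) ?_ ?_
  · exact fun T hT => (map_eq_zero _).1 (key T hT)
  · intro s' hs' h0 T hT
    rw [eq_zero_of_sum_tabProd_triPoint (fun T hT => hs T (hs' hT)) c ?_ T hT, map_zero]
    refine FaithfulSMul.algebraMap_injective (MvPolynomial (Slot r) F) (TriField F r) ?_
    rw [map_zero, ← h0, map_sum]
    refine Finset.sum_congr rfl fun U _ => ?_
    rw [map_mul, map_tabProd, ← innerFamily_triQuot_map_eval_zero, ← map_tabProd, coe_evalRingHom,
      coeff_zero_eq_eval_zero, IsScalarTower.algebraMap_apply F (MvPolynomial (Slot r) F)]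
    rfl
  · rw [← h]
    refine Finset.sum_congr rfl fun T _ => ?_
    rw [tabProd_isoFamily, Algebra.smul_def]
    rfl

end Target

section NonVanishing

theorem map_pf {m : ℕ} {S S' H : Type*} [CommRing S] [CommRing S'] [FunLike H S S']
    [RingHomClass H S S'] (φ : H) (A : Matrix (Fin m) (Fin m) S) : φ (pf A) = pf (A.map φ) := by
  simp only [pf, map_sum, map_zsmul, map_prod, Matrix.map_apply]

theorem pf_stdAlt {m : ℕ} (hm : Even m) (S : Type*) [CommRing S] :
    pf (Matrix.of fun a b : Fin m => (stdAlt a b : S)) = 1 := by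
  rw [pf, Finset.sum_eq_single 1]
  · have h : ∀ i : Fin (m / 2), stdAlt (2 * i) (2 * i + 1) = 1 := fun i => by simp [stdAlt]
    simp [h]
  · intro σ hσ hne
    rw [Nat.even_iff] at hm
    obtain ⟨hpair, hmono⟩ := (Finset.mem_filter.1 hσ).2
    by_contra hterm
    have hprod : ∀ i : Fin (m / 2), stdAlt (σ ⟨2 * i, by omega⟩) (σ ⟨2 * i + 1, by omega⟩) ≠ 0 := by
      intro i hi
      refine hterm ?_
      rw [Finset.prod_eq_zero (Finset.mem_univ i), smul_zero]
      rw [Matrix.of_apply, hi, Int.cast_zero]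
    have hval : ∀ i : Fin (m / 2), (σ ⟨2 * i, by omega⟩ : ℕ) % 2 = 0 ∧
        (σ ⟨2 * i + 1, by omega⟩ : ℕ) = σ ⟨2 * i, by omega⟩ + 1 := by
      intro i
      have h1 := hprod i
      have h2 := Fin.lt_def.1 (hpair i)
      by_contra h
      rw [stdAlt, if_neg (by rwa [Nat.even_iff]), if_neg (by omega)] at h1
      exact h1 rfl
    have hhalf : StrictMono fun i : Fin (m / 2) =>
        (⟨(σ ⟨2 * i, by omega⟩ : ℕ) / 2, by omega⟩ : Fin (m / 2)) := by
      intro i j hij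
      have h1 := Fin.lt_def.1 (hmono i j hij)
      have h2 := (hval i).1
      have h3 := (hval j).1
      rw [Fin.lt_def]
      dsimp only
      omega
    have heven : ∀ i : Fin (m / 2), (σ ⟨2 * i, by omega⟩ : ℕ) = 2 * i := by
      intro i
      have h1 := Fin.le_def.1 (hhalf.le_apply (x := i))
      have h2 := Fin.le_def.1 (hhalf.apply_le (x := i))
      have h3 := (hval i).1
      dsimp only at h1 h2
      omega
    refine hne (Equiv.ext fun a => Fin.ext ?_)
    have ha : (a : ℕ) / 2 < m / 2 := by omega
    rcases Nat.even_or_odd' (a : ℕ) with ⟨c, hc | hc⟩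
    · rw [show a = ⟨2 * c, by omega⟩ from Fin.ext hc]
      exact heven ⟨c, by omega⟩
    · rw [show a = ⟨2 * c + 1, by omega⟩ from Fin.ext hc]
      have h1 := (hval ⟨c, by omega⟩).2
      rw [heven] at h1
      exact h1
  · intro h
    refine absurd (Finset.mem_filter.2 ⟨Finset.mem_univ _, fun i => ?_, fun i j hij => ?_⟩) h
    · simp
    · simpa using hij

variable {r : ℕ} {F : Type*} [Field F]

theorem listPf_finRange_embBar {S : Type*} [CommRing S]
    (Y : Matrix (Fin (2 * r)) (Fin (2 * r)) S) :
    listPf Y ((List.finRange r).map (embBar r)) =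
      pf ((Y.submatrix idx idx).submatrix (fun p : Fin r => (p, false)) fun p => (p, false)) := by
  have key : ∀ (m : ℕ) (h : m = r), pf (Matrix.of fun a b : Fin m =>
      Y (embBar r (a.cast h)) (embBar r (b.cast h))) = pf ((Y.submatrix idx idx).submatrix
        (fun p : Fin r => (p, false)) fun p => (p, false)) := by
    rintro m rfl
    rfl
  rw [← key _ (by simp : ((List.finRange r).map (embBar r)).length = r), listPf]
  congr
  ext a b
  simp
  rfl

theorem pf_triPoint_ne_zero (hr : Even r) :
    pf ((triPoint F r).submatrix (fun p : Fin r => (p, false)) fun p => (p, false)) ≠ 0 := by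
  classical
  intro h
  set φ : MvPolynomial (Slot r) F →+* F := MvPolynomial.eval fun v =>
    if ((ofLex v).1 : ℕ) = 2 * (ofLex v).2 then 1 else 0
  have hφ : ∀ p t : Fin r, φ (triGeneric F r (p, false) t) = (1 : Matrix (Fin r) (Fin r) F) p t := by
    intro p t
    rw [triGeneric, Matrix.of_apply, Matrix.one_apply]
    split_ifs with h1 h2 h2
    · simp [φ, slot, idxPos, h2]
    · have : ¬ (p : ℕ) = t := fun h => h2 (Fin.ext h)
      simp [φ, slot, idxPos, this]
    · exact absurd h2.ge h1
    · exact map_zero φ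
  have hmap : ((triPoint F r).submatrix (fun p : Fin r => (p, false)) fun p => (p, false)).map φ =
      Matrix.of fun a b : Fin r => (stdAlt a b : F) := by
    have h1 : ((triGeneric F r).submatrix (fun p : Fin r => (p, false)) id).map φ = 1 :=
      Matrix.ext hφ
    have h2 : (triPoint F r).submatrix (fun p : Fin r => (p, false)) (fun p => (p, false)) =
        (triGeneric F r).submatrix (fun p : Fin r => (p, false)) id * stdAltMat r _ *
          ((triGeneric F r).submatrix (fun p : Fin r => (p, false)) id)ᵀ := rfl
    rw [h2, Matrix.map_mul, Matrix.map_mul, Matrix.transpose_map, h1, stdAltMat_map,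
      Matrix.transpose_one, Matrix.one_mul, Matrix.mul_one]
    rfl
  have := congrArg φ h
  rw [map_pf, hmap, pf_stdAlt hr, map_zero] at this
  exact one_ne_zero this

open Polynomial in
theorem pf_isoFamily_ne_zero (hr : Even r) :
    pf ((isoFamily (triQuot F r) (barBlock F r)).submatrix (fun p : Fin r => (p, false))
      fun p => (p, false)) ≠ 0 := by
  intro h
  have hmap : ((isoFamily (triQuot F r) (barBlock F r)).submatrix (fun p : Fin r => (p, false))
      fun p => (p, false)).map (evalRingHom 1) =
      ((triPoint F r).submatrix (fun p : Fin r => (p, false)) fun p => (p, false)).map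
        (algebraMap _ (TriField F r)) := by
    have hinner : (innerFamily (triQuot F r) (barBlock F r)).submatrix
        (fun p : Fin r => (p, false)) (fun p => (p, false)) = 1 * (barBlock F r).map C * 1ᵀ := rfl
    have hbar : barBlock F r = ((triPoint F r).submatrix (fun p : Fin r => (p, false))
        fun p => (p, false)).map (algebraMap _ (TriField F r)) := by
      have h2 : (triPoint F r).submatrix (fun p : Fin r => (p, false)) (fun p => (p, false)) =
          (triGeneric F r).submatrix (fun p : Fin r => (p, false)) id * stdAltMat r _ *
            ((triGeneric F r).submatrix (fun p : Fin r => (p, false)) id)ᵀ := rfl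
      rw [h2, Matrix.map_mul, Matrix.map_mul, Matrix.transpose_map, stdAltMat_map]
      rfl
    rw [← hbar]
    refine Matrix.ext fun p q => ?_
    have hpq := congrFun (congrFun hinner p) q
    rw [Matrix.transpose_one, Matrix.one_mul, Matrix.mul_one, Matrix.submatrix_apply] at hpq
    rw [Matrix.map_apply, Matrix.submatrix_apply, isoFamily, Matrix.of_apply, hpq]
    simp
  have h1 := congrArg (evalRingHom (1 : TriField F r)) h
  rw [map_pf, hmap, ← map_pf, map_zero, FaithfulSMul.algebraMap_eq_zero_iff] at h1
  exact pf_triPoint_ne_zero hr h1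

end NonVanishing

/-- For `n = 2r` divisible by 4 and a field `F` with `char F = 0` or
`char F > r`, the pfaffian `[r+1, r+2, …, n]`, regarded as an element of `F[V]`, is not a
zero divisor. -/
theorem pfaffian_mem_nonZeroDivisors (r : ℕ) (h4 : 4 ∣ 2 * r) (F : Type*) [Field F]
    (hchar : ringChar F = 0 ∨ r < ringChar F) :
    Ideal.Quotient.mk (VIdeal r F) (listPf (Ygen r F) ((List.finRange r).map (embBar r)))
      ∈ nonZeroDivisors (FV r F) := by
  have hr : Even r := by
    rw [Nat.even_iff]
    omega
  obtain ⟨ψ, hψ⟩ := exists_algHom_isoFamily (F := F) (triQuot F r) (E := barBlock F r)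
    ((isAltMat_stdAltMat r).mul_mul_transpose _)
  rw [mem_nonZeroDivisors_iff_right]
  intro x hx
  have hpf : ψ (Ideal.Quotient.mk (VIdeal r F)
      (listPf (Ygen r F) ((List.finRange r).map (embBar r)))) ≠ 0 := by
    have h : Ideal.Quotient.mk (VIdeal r F)
        (listPf (Ygen r F) ((List.finRange r).map (embBar r))) =
        pf (((genericPoint F r).submatrix idx idx).submatrix (fun p : Fin r => (p, false))
          fun p => (p, false)) := by
      rw [listPf_finRange_embBar, map_pf]
      rfl
    rw [h, map_pf, ← Matrix.submatrix_map, hψ]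
    exact pf_isoFamily_ne_zero hr
  have hψx : ψ x = 0 := by
    have h := congrArg ψ hx
    rw [map_mul, map_zero] at h
    exact (mul_eq_zero.1 h).resolve_right hpf
  have hspan : x ∈ Submodule.span F
      (tabProd ((genericPoint F r).submatrix idx idx) '' {T | IsStdTab T}) := by
    rw [span_tabProd_eq_top F hr hchar]
    trivial
  obtain ⟨l, hl, rfl⟩ := (Finsupp.mem_span_image_iff_linearCombination F).1 hspan
  have hsum : ∑ T ∈ l.support, l T • tabProd (isoFamily (triQuot F r) (barBlock F r)) T = 0 := by
    rw [← hψx, Finsupp.linearCombination_apply, Finsupp.sum, map_sum]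
    refine Finset.sum_congr rfl fun T _ => ?_
    rw [map_smul, ← hψ]
    exact congrArg _ (map_tabProd ψ _ T).symm
  have hzero := eq_zero_of_sum_tabProd_isoFamily (fun T hT => hl hT) l hsum
  have hl0 : l = 0 := by
    ext T
    by_contra h
    exact h (hzero T (Finsupp.mem_support_iff.2 h))
  rw [hl0, map_zero]

end PR
end
end

section
/- Let n = 2r be an integer divisible by 4 and let F be a field with char F = 0 or char F > r. Let f be the determinant of the r×r submatrix of the matrix of indeterminates Y consisting of the rows r+1, …, n and columns r+1, …, n, regarded as an element of F[V]. Then there exists a polynomial g in the polynomial ring B over F in r² indeterminates such that the localization of F[V] at the multiplicative set of powers of f is isomorphic, as an F-algebra, to the localization of B at the multiplicative set of powers of g. -/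
open scoped Matrix

noncomputable section

namespace PR

section BlockDecomposition

/-- The splitting of the indices `1, …, 2r` into `1, …, r` and `1̄, …, r̄`. -/
def sumEquiv (r : ℕ) : Fin r ⊕ Fin r ≃ Fin (2 * r) :=
  finSumFinEquiv.trans (finCongr (two_mul r).symm)

@[simp]
theorem sumEquiv_inl (r : ℕ) (i : Fin r) : sumEquiv r (Sum.inl i) = emb r i := rfl

@[simp]
theorem sumEquiv_inr (r : ℕ) (i : Fin r) : sumEquiv r (Sum.inr i) = embBar r i := rfl

theorem Jmat_submatrix (r : ℕ) (C : Type*) [CommRing C] :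
    (Jmat r C).submatrix (sumEquiv r) (sumEquiv r) = Matrix.fromBlocks 0 1 (-1) 0 := by
  ext i j
  rcases i with i | i <;> rcases j with j | j <;>
    have hi := i.isLt <;> have hj := j.isLt <;>
    simp only [Matrix.submatrix_apply, sumEquiv_inl, sumEquiv_inr, Jmat, Matrix.of_apply, emb,
      embBar, Matrix.fromBlocks_apply₁₁, Matrix.fromBlocks_apply₁₂, Matrix.fromBlocks_apply₂₁,
      Matrix.fromBlocks_apply₂₂, Matrix.zero_apply, Matrix.neg_apply, Matrix.one_apply,
      Fin.ext_iff] <;> split_ifs <;> first | rfl | omega | simp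

variable {r : ℕ} {C : Type*} [CommRing C]

theorem MemV.map {C' : Type*} [CommRing C'] {Y : Matrix (Fin (2 * r)) (Fin (2 * r)) C}
    (h : MemV r Y) (φ : C →+* C') : MemV r (Y.map φ) := by
  obtain ⟨h1, h2, h3, h4⟩ := h
  have hJ : Jmat r C' = (Jmat r C).map φ := by
    ext i j
    simp only [Jmat, Matrix.of_apply, Matrix.map_apply]
    split_ifs <;> simp
  refine ⟨?_, fun i => by simp [h2 i], ?_, ?_⟩
  · ext i j
    simpa using congrArg φ (congrFun (congrFun h1 i) j)
  · rw [hJ, ← Matrix.transpose_map, ← Matrix.map_mul, ← Matrix.map_mul, h3]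
    simp
  · have : -(Jmat r C' * Y.map φ) = (-(Jmat r C * Y)).map φ := by
      rw [hJ, ← Matrix.map_mul, Matrix.map_neg _ (map_neg φ)]
    rw [this, Matrix.charpoly_map, h4]
    simp

/-- The matrix with lower right block `D` and upper right block `D⁻¹ * S` which, for `D`
alternating and `S` symmetric, squares to zero with respect to the symplectic form. -/
def paramBlocks (D S : Matrix (Fin r) (Fin r) C) : Matrix (Fin r ⊕ Fin r) (Fin r ⊕ Fin r) C :=
  Matrix.fromBlocks (D⁻¹ * S * D⁻¹ * S * D⁻¹) (D⁻¹ * S) (-(D⁻¹ * S)ᵀ) D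

/-- `paramBlocks` on the index set `1, …, 2r`. -/
def paramMat (D S : Matrix (Fin r) (Fin r) C) : Matrix (Fin (2 * r)) (Fin (2 * r)) C :=
  (paramBlocks D S).submatrix (sumEquiv r).symm (sumEquiv r).symm

theorem map_nonsing_inv {C' : Type*} [CommRing C'] (φ : C →+* C')
    {D : Matrix (Fin r) (Fin r) C} (hD : IsUnit D.det) : D⁻¹.map φ = (D.map φ)⁻¹ := by
  refine (Matrix.inv_eq_left_inv ?_).symm
  rw [← Matrix.map_mul, Matrix.nonsing_inv_mul _ hD]
  simp

theorem paramMat_map {C' : Type*} [CommRing C'] (φ : C →+* C')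
    {D S : Matrix (Fin r) (Fin r) C} (hD : IsUnit D.det) :
    (paramMat D S).map φ = paramMat (D.map φ) (S.map φ) := by
  rw [paramMat, paramMat, ← Matrix.submatrix_map, paramBlocks, paramBlocks,
    Matrix.fromBlocks_map, ← map_nonsing_inv φ hD]
  simp only [Matrix.map_mul, Matrix.map_neg _ (map_neg φ), Matrix.transpose_map]

theorem mul_mul_transpose_apply_self {A : Matrix (Fin r) (Fin r) C} (hA : Aᵀ = -A)
    (hA0 : ∀ i, A i i = 0) (P : Matrix (Fin r) (Fin r) C) (i : Fin r) :
    (P * A * Pᵀ) i i = 0 := by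
  have hA' : ∀ k l, A l k = -A k l := fun k l => congrFun (congrFun hA k) l
  simp only [Matrix.mul_apply, Matrix.transpose_apply, Finset.sum_mul]
  rw [← Finset.sum_product']
  refine Finset.sum_involution (fun p _ => (p.2, p.1)) ?_ ?_ (by simp) (by simp)
  · rintro ⟨k, l⟩ -
    simp only [hA' k l]
    ring
  · rintro ⟨k, l⟩ - hne heq
    obtain rfl : l = k := by simpa using congrArg Prod.fst heq
    simp [hA0] at hne

theorem memV_paramMat [IsReduced C] {D S : Matrix (Fin r) (Fin r) C} (hD : Dᵀ = -D)
    (hD0 : ∀ i, D i i = 0) (hS : Sᵀ = S) (hdet : IsUnit D.det) : MemV r (paramMat D S) := by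
  have hDi : D⁻¹ᵀ = -D⁻¹ := by
    rw [Matrix.transpose_nonsing_inv, hD]
    exact Matrix.inv_eq_left_inv (by simp [Matrix.nonsing_inv_mul _ hdet])
  have hDi0 : ∀ i, D⁻¹ i i = 0 := fun i => by
    have h := mul_mul_transpose_apply_self hD hD0 D⁻¹ i
    rw [Matrix.nonsing_inv_mul _ hdet, one_mul, hDi] at h
    simpa using h
  have hB : (D⁻¹ * S)ᵀ = -(S * D⁻¹) := by
    rw [Matrix.transpose_mul, hS, hDi, Matrix.mul_neg]
  have hA : D⁻¹ * S * D⁻¹ * S * D⁻¹ = -(D⁻¹ * S * D⁻¹ * (D⁻¹ * S)ᵀ) := by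
    rw [hB]
    simp only [Matrix.mul_neg, neg_neg, Matrix.mul_assoc]
  have hJ : Jmat r C = (Matrix.fromBlocks 0 1 (-1) 0).submatrix (sumEquiv r).symm
      (sumEquiv r).symm := by
    rw [← Jmat_submatrix]
    simp
  have hskew : (paramMat D S)ᵀ = -paramMat D S := by
    suffices h : (paramBlocks D S)ᵀ = -paramBlocks D S by
      rw [paramMat, Matrix.transpose_submatrix, h]
      rfl
    rw [paramBlocks, Matrix.fromBlocks_transpose, Matrix.fromBlocks_neg, hD]
    simp only [Matrix.transpose_mul, hS, hDi,
      Matrix.mul_neg, Matrix.neg_mul, neg_neg, Matrix.mul_assoc]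
  have hsq : paramMat D S * Jmat r C * paramMat D S = 0 := by
    rw [paramMat, hJ, Matrix.submatrix_mul_equiv, Matrix.submatrix_mul_equiv, paramBlocks,
      Matrix.fromBlocks_multiply, Matrix.fromBlocks_multiply, hB]
    simp [Matrix.mul_assoc, Matrix.mul_nonsing_inv_cancel_left,
      hdet, Matrix.nonsing_inv_mul]
  refine ⟨by rw [hskew, neg_neg], fun i => ?_, by rw [hskew]; simp [hsq], ?_⟩
  · obtain ⟨i, rfl⟩ := (sumEquiv r).surjective i
    rcases i with i | i
    · simp only [paramMat, paramBlocks, Matrix.submatrix_apply, Equiv.symm_apply_apply,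
        Matrix.fromBlocks_apply₁₁]
      rw [hA, Matrix.neg_apply, mul_mul_transpose_apply_self hDi hDi0, neg_zero]
    · simpa only [paramMat, paramBlocks, Matrix.submatrix_apply, Equiv.symm_apply_apply,
        Matrix.fromBlocks_apply₂₂] using hD0 i
  · have hnil : IsNilpotent (-(Jmat r C * paramMat D S)) := by
      refine ⟨2, ?_⟩
      rw [pow_two, neg_mul_neg, Matrix.mul_assoc, ← Matrix.mul_assoc (paramMat D S), hsq,
        Matrix.mul_zero]
    have h := Polynomial.isNilpotent_iff.mp
      (Matrix.isNilpotent_charpoly_sub_pow_of_isNilpotent hnil)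
    rw [Fintype.card_fin] at h
    exact sub_eq_zero.mp (Polynomial.ext fun k => by simpa using (h k).eq_zero)

/-- The lower right block of a matrix. -/
def blockD (Y : Matrix (Fin (2 * r)) (Fin (2 * r)) C) : Matrix (Fin r) (Fin r) C :=
  Y.submatrix (embBar r) (embBar r)

/-- The upper right block of a matrix. -/
def blockB (Y : Matrix (Fin (2 * r)) (Fin (2 * r)) C) : Matrix (Fin r) (Fin r) C :=
  Y.submatrix (emb r) (embBar r)

theorem blockD_paramMat (D S : Matrix (Fin r) (Fin r) C) : blockD (paramMat D S) = D := by
  ext i j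
  simp [blockD, paramMat, paramBlocks, ← sumEquiv_inr]

theorem blockB_paramMat (D S : Matrix (Fin r) (Fin r) C) :
    blockB (paramMat D S) = D⁻¹ * S := by
  ext i j
  simp [blockB, paramMat, paramBlocks, ← sumEquiv_inr, ← sumEquiv_inl]

theorem MemV.blockD_transpose {Y : Matrix (Fin (2 * r)) (Fin (2 * r)) C} (h : MemV r Y) :
    (blockD Y)ᵀ = -blockD Y := by
  ext i j
  simpa [blockD] using congrFun (congrFun h.1 (embBar r j)) (embBar r i)

theorem MemV.blocks {Y : Matrix (Fin (2 * r)) (Fin (2 * r)) C} (h : MemV r Y) :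
    (blockD Y * blockB Y)ᵀ = blockD Y * blockB Y ∧
      (IsUnit (blockD Y).det → paramMat (blockD Y) (blockD Y * blockB Y) = Y) := by
  have hD := h.blockD_transpose
  obtain ⟨h1, -, h3, -⟩ := h
  set A : Matrix (Fin r) (Fin r) C := Y.submatrix (emb r) (emb r) with hA
  set B := blockB Y with hB
  set D := blockD Y with hD'
  have hY : Y.submatrix (sumEquiv r) (sumEquiv r) = Matrix.fromBlocks A B (-Bᵀ) D := by
    ext i j
    rcases i with i | i <;> rcases j with j | j <;> simp [hA, hB, hD', blockB, blockD]
    exact congrFun (congrFun h1 (embBar r i)) (emb r j)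
  have hsq : Matrix.fromBlocks A B (-Bᵀ) D * Matrix.fromBlocks 0 1 (-1) 0 *
      Matrix.fromBlocks A B (-Bᵀ) D = 0 := by
    have h3' : Y * Jmat r C * Y = 0 := by
      have : Yᵀ = -Y := by rw [eq_neg_iff_add_eq_zero, add_comm, ← eq_neg_iff_add_eq_zero, ← h1]
      rw [this] at h3
      simpa using h3
    rw [← hY, ← Jmat_submatrix, Matrix.submatrix_mul_equiv, Matrix.submatrix_mul_equiv, h3']
    rfl
  rw [Matrix.fromBlocks_multiply, Matrix.fromBlocks_multiply, ← Matrix.fromBlocks_zero,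
    Matrix.fromBlocks_inj] at hsq
  obtain ⟨-, hAB, -, hBD⟩ := hsq
  have hsym : (D * B)ᵀ = D * B := by
    rw [Matrix.transpose_mul, hD, Matrix.mul_neg]
    simp only [Matrix.mul_zero, Matrix.mul_one, Matrix.mul_neg, zero_add, add_zero,
      Matrix.neg_mul] at hBD
    exact (neg_add_eq_zero.mp hBD).symm
  refine ⟨hsym, fun hdet => ?_⟩
  have hAD : A * D = B * B := by
    simp only [Matrix.mul_zero, Matrix.mul_one, Matrix.mul_neg, zero_add, add_zero,
      Matrix.neg_mul] at hAB
    exact (neg_add_eq_zero.mp hAB).symm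
  rw [paramMat, paramBlocks]
  simp only [Matrix.mul_assoc, Matrix.nonsing_inv_mul_cancel_left _ _ hdet]
  rw [← Matrix.mul_assoc B B, ← hAD, Matrix.mul_nonsing_inv_cancel_right _ _ hdet, ← hY]
  simp

/-- The alternating matrix with prescribed entries above the diagonal. -/
def altOf (x : Fin r × Fin r → C) : Matrix (Fin r) (Fin r) C :=
  Matrix.of fun i j => if i < j then x (i, j) else if j < i then -x (j, i) else 0

/-- The symmetric matrix with prescribed entries on and below the diagonal. -/
def symOf (x : Fin r × Fin r → C) : Matrix (Fin r) (Fin r) C :=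
  Matrix.of fun i j => if j ≤ i then x (i, j) else x (j, i)

/-- The coordinates of a pair consisting of an alternating and a symmetric matrix. -/
def coords (D S : Matrix (Fin r) (Fin r) C) (p : Fin r × Fin r) : C :=
  if p.1 < p.2 then D p.1 p.2 else S p.1 p.2

theorem altOf_transpose (x : Fin r × Fin r → C) : (altOf x)ᵀ = -altOf x := by
  ext i j
  rcases lt_trichotomy i j with h | rfl | h <;> simp [altOf, *, not_lt_of_gt]

theorem altOf_apply_self (x : Fin r × Fin r → C) (i : Fin r) : altOf x i i = 0 := by
  simp [altOf]

theorem symOf_transpose {α : Type*} (x : Fin r × Fin r → α) : (symOf x)ᵀ = symOf x := by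
  ext i j
  rcases lt_trichotomy i j with h | rfl | h <;> simp [symOf, *, not_le_of_gt, le_of_lt]

theorem altOf_map {C' : Type*} [CommRing C'] (φ : C →+* C') (x : Fin r × Fin r → C) :
    (altOf x).map φ = altOf (φ ∘ x) := by
  ext i j
  simp only [altOf, Matrix.map_apply, Matrix.of_apply]
  split_ifs <;> simp

theorem symOf_map {C' : Type*} [CommRing C'] (φ : C →+* C') (x : Fin r × Fin r → C) :
    (symOf x).map φ = symOf (φ ∘ x) := by
  ext i j
  simp only [symOf, Matrix.map_apply, Matrix.of_apply]
  split_ifs <;> simp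

theorem altOf_coords {D : Matrix (Fin r) (Fin r) C} (hD : Dᵀ = -D) (hD0 : ∀ i, D i i = 0)
    (S : Matrix (Fin r) (Fin r) C) : altOf (coords D S) = D := by
  ext i j
  have h' : D i j = -D j i := congrFun (congrFun hD j) i
  rcases lt_trichotomy i j with h | rfl | h <;> simp [altOf, coords, *, not_lt_of_gt]

theorem symOf_coords {α : Type*} {S : Matrix (Fin r) (Fin r) α} (hS : Sᵀ = S)
    (D : Matrix (Fin r) (Fin r) α) : symOf (coords D S) = S := by
  ext i j
  have h' : S j i = S i j := congrFun (congrFun hS i) j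
  rcases lt_trichotomy i j with h | rfl | h <;>
    simp [symOf, coords, *, not_lt_of_gt, not_le_of_gt, le_of_lt]

theorem coords_altOf_symOf (x : Fin r × Fin r → C) : coords (altOf x) (symOf x) = x := by
  ext ⟨i, j⟩
  by_cases h : i < j
  · simp [coords, altOf, h]
  · simp [coords, symOf, h, not_lt.mp h]

end BlockDecomposition

section UniversalProperty

variable {r : ℕ} {F C : Type*} [CommRing F] [CommRing C]

theorem memV_map_Ygen_iff (φ : PolyRing r F →+* C) :
    MemV r ((Ygen r F).map φ) ↔ VIdeal r F ≤ RingHom.ker φ := by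
  have hJ : Jmat r C = (Jmat r (PolyRing r F)).map φ := by
    ext i j
    simp only [Jmat, Matrix.of_apply, Matrix.map_apply]
    split_ifs <;> simp
  have hN : -(Jmat r C * (Ygen r F).map φ) = (-(Jmat r (PolyRing r F) * Ygen r F)).map φ := by
    rw [hJ, ← Matrix.map_mul, Matrix.map_neg _ (map_neg φ)]
  rw [MemV, hN, Matrix.charpoly_map, hJ, ← Matrix.transpose_map, ← Matrix.map_mul,
    ← Matrix.map_mul, VIdeal, Ideal.span_le]
  rw [Set.union_subset_iff, Set.union_subset_iff, Set.union_subset_iff]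
  simp only [Set.subset_def, Set.mem_ofPred_eq, SetLike.mem_coe,
    RingHom.mem_ker, forall_exists_index, ← Matrix.ext_iff, Polynomial.ext_iff, and_assoc]
  refine and_congr ?_ (and_congr ?_ (and_congr ?_ ?_))
  · constructor
    · rintro h _ i j rfl
      simpa [eq_neg_iff_add_eq_zero] using h i j
    · intro h i j
      simpa [eq_neg_iff_add_eq_zero] using h _ i j rfl
  · exact ⟨fun h _ i hp => hp ▸ h i, fun h i => h _ i rfl⟩
  · exact ⟨fun h _ i j hp => hp ▸ h i j, fun h i j => h _ i j rfl⟩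
  · constructor
    · rintro h _ k rfl
      have := h k
      simp only [Polynomial.coeff_map, Polynomial.coeff_X_pow] at this
      simp only [Polynomial.coeff_sub, Polynomial.coeff_X_pow, map_sub, this]
      split_ifs <;> simp
    · intro h k
      have := h _ k rfl
      simp only [Polynomial.coeff_sub, Polynomial.coeff_X_pow, map_sub, sub_eq_zero] at this
      simp only [Polynomial.coeff_map, Polynomial.coeff_X_pow, this]
      split_ifs <;> simp

end UniversalProperty

/-- For `n = 2r` divisible by 4 and a field `F` with `char F = 0` or
`char F > r`, with `f` the determinant of the submatrix of `Y` on rows and columns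
`r+1, …, n`, the localization of `F[V]` at the powers of `f` is `F`-algebra isomorphic to
the localization of a polynomial ring in `r²` indeterminates at the powers of some
polynomial `g`. -/
theorem localization_FV_isOpen_affine (r : ℕ) (h4 : 4 ∣ 2 * r) (F : Type*) [Field F]
    (hchar : ringChar F = 0 ∨ r < ringChar F) :
    ∃ g : MvPolynomial (Fin (r ^ 2)) F,
      Nonempty
        (Localization.Away
            (Ideal.Quotient.mk (VIdeal r F)
              (Matrix.det (Matrix.of fun i j : Fin r => Ygen r F (embBar r i) (embBar r j))))
          ≃ₐ[F] Localization.Away g) := by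
  let e : Fin r × Fin r ≃ Fin (r ^ 2) := finProdFinEquiv.trans (finCongr (pow_two r).symm)
  let g : MvPolynomial (Fin (r ^ 2)) F := (altOf fun p => MvPolynomial.X (e p)).det
  refine ⟨g, ⟨?_⟩⟩
  set f : FV r F := Ideal.Quotient.mk (VIdeal r F)
    (Matrix.det (Matrix.of fun i j : Fin r => Ygen r F (embBar r i) (embBar r j)))
  let x : Fin r × Fin r → Localization.Away g := fun p =>
    algebraMap (MvPolynomial (Fin (r ^ 2)) F) _ (MvPolynomial.X (e p))
  have hx : IsUnit (altOf x).det := by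
    have h := IsLocalization.Away.algebraMap_isUnit (S := Localization.Away g) g
    rwa [RingHom.map_det, RingHom.mapMatrix_apply, altOf_map] at h
  have : IsReduced (Localization.Away g) :=
    isReduced_localizationPreserves (Submonoid.powers g) _ inferInstance
  have hV : MemV r (paramMat (altOf x) (symOf x)) :=
    memV_paramMat (altOf_transpose x) (altOf_apply_self x) (symOf_transpose x) hx
  let φ₀ : PolyRing r F →ₐ[F] Localization.Away g :=
    MvPolynomial.aeval fun p => paramMat (altOf x) (symOf x) p.1 p.2
  have hφ₀ : (Ygen r F).map φ₀ = paramMat (altOf x) (symOf x) := by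
    ext i j
    simp [φ₀, Ygen]
  let φ₁ : FV r F →ₐ[F] Localization.Away g := Ideal.Quotient.liftₐ (VIdeal r F) φ₀
    ((memV_map_Ygen_iff φ₀.toRingHom).mp (hφ₀ ▸ hV))
  have hφ₁ : IsUnit (φ₁ f) := by
    have h : φ₁ f = (blockD ((Ygen r F).map φ₀)).det := AlgHom.map_det φ₀ _
    rwa [h, hφ₀, blockD_paramMat]
  let φ : Localization.Away f →ₐ[F] Localization.Away g := IsLocalization.Away.liftAlgHom f hφ₁
  let ι : PolyRing r F →+* Localization.Away f :=
    (algebraMap (FV r F) (Localization.Away f)).comp (Ideal.Quotient.mk (VIdeal r F))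
  let U := (Ygen r F).map ι
  have hU : MemV r U := by
    refine (memV_map_Ygen_iff ι).mpr fun p hp => ?_
    rw [RingHom.mem_ker, RingHom.comp_apply, Ideal.Quotient.eq_zero_iff_mem.mpr hp, map_zero]
  have hUf : (blockD U).det = algebraMap _ _ f := (RingHom.map_det ι _).symm
  have hUd : IsUnit (blockD U).det := hUf ▸ IsLocalization.Away.algebraMap_isUnit f
  let y := coords (blockD U) (blockD U * blockB U)
  have hyD : altOf y = blockD U := altOf_coords hU.blockD_transpose (fun i => hU.2.1 _) _
  have hyS : symOf y = blockD U * blockB U := symOf_coords hU.blocks.1 _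
  let ψ₀ : MvPolynomial (Fin (r ^ 2)) F →ₐ[F] Localization.Away f :=
    MvPolynomial.aeval fun k => y (e.symm k)
  have hψ₀ : ∀ p, ψ₀ (MvPolynomial.X (e p)) = y p := fun p => by simp [ψ₀]
  have hψ₀g : IsUnit (ψ₀ g) := by
    have h : ψ₀ g = (altOf y).det := by
      rw [← AlgHom.coe_toRingHom, RingHom.map_det, RingHom.mapMatrix_apply, altOf_map]
      exact congrArg (fun z => (altOf z).det) (funext hψ₀)
    rwa [h, hyD]
  let ψ : Localization.Away g →ₐ[F] Localization.Away f := IsLocalization.Away.liftAlgHom g hψ₀g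
  have hψx : ψ ∘ x = y := by
    ext p
    exact (IsLocalization.Away.lift_eq g hψ₀g _).trans (hψ₀ p)
  have hφU : U.map φ = paramMat (altOf x) (symOf x) := by
    rw [← hφ₀]
    ext i j
    exact IsLocalization.Away.lift_eq f hφ₁ _
  have hφy : φ ∘ y = x := by
    have hD : (blockD U).map φ = altOf x := by
      rw [← blockD_paramMat (altOf x) (symOf x), ← hφU]
      rfl
    have hB : (blockB U).map φ = (altOf x)⁻¹ * symOf x := by
      rw [← blockB_paramMat (altOf x) (symOf x), ← hφU]
      rfl
    rw [← coords_altOf_symOf (φ ∘ y), ← coords_altOf_symOf x]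
    congr 1
    · exact (altOf_map φ.toRingHom y).symm.trans (hyD ▸ hD)
    · refine (symOf_map φ.toRingHom y).symm.trans ?_
      rw [hyS, Matrix.map_mul]
      refine (congrArg₂ _ hD hB).trans ?_
      rw [Matrix.mul_nonsing_inv_cancel_left _ _ hx]
  have hψU : (paramMat (altOf x) (symOf x)).map ψ = U := by
    refine (paramMat_map ψ.toRingHom hx).trans ?_
    rw [altOf_map, symOf_map]
    change paramMat (altOf (ψ ∘ x)) (symOf (ψ ∘ x)) = U
    rw [hψx, hyD, hyS, hU.blocks.2 hUd]
  refine AlgEquiv.ofAlgHom φ ψ ?_ ?_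
  · refine AlgHom.coe_ringHom_injective (IsLocalization.ringHom_ext (Submonoid.powers g) ?_)
    refine MvPolynomial.ringHom_ext (fun a => ?_) fun k => ?_
    · exact (φ.comp ψ).commutes a
    · obtain ⟨p, rfl⟩ := e.surjective k
      exact (congrArg φ (congrFun hψx p)).trans (congrFun hφy p)
  · refine AlgHom.coe_ringHom_injective (IsLocalization.ringHom_ext (Submonoid.powers f) ?_)
    refine Ideal.Quotient.ringHom_ext (MvPolynomial.ringHom_ext (fun a => ?_) fun p => ?_)
    · exact (ψ.comp φ).commutes a
    · exact (congrArg ψ (congrFun (congrFun hφU p.1) p.2)).trans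
        (congrFun (congrFun hψU p.1) p.2)

end PR
end
end
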